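/- arXiv:2604.02067 — 5 statements merged into one kernel-verified Lean document; each statement's English description precedes it below -/
import Mathlib

section
/- Let q be a power of an odd prime p, let n be a positive integer, and let f(X) = a_1X_1² + ⋯ + a_nX_n² with a_i ∈ 𝔽_q^×. Let ϖ ∈ 𝔽_q[t] be monic irreducible and k ≥ 1. Define S_{ϖ^k}(f) = Σ_{a coprime to ϖ, deg(a) < k·deg(ϖ)} Σ_{b ∈ 𝔽_q[t]^n, deg(b_i) < k·deg(ϖ)} ψ(a f(b)/ϖ^k). If n is odd and k is odd, then S_{ϖ^k}(f) = 0. -/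
open Polynomial
open scoped Classical

/-- The standard additive character `ψ(x/r)` of `𝔽_q((1/t))` evaluated at `x/r` for
polynomials `x, r` with `r` monic: it equals `e_q(c)` where `c` is the coefficient of
`t^{deg r - 1}` in `x mod r`, and `e_q(a) = exp(2πi·Tr_{𝔽_q/𝔽_p}(a)/p)`. -/
noncomputable def polyPsi (p : ℕ) [Fact p.Prime] {Fq : Type} [Field Fq]
    [Algebra (ZMod p) Fq] (r x : Polynomial Fq) : ℂ :=
  Complex.exp (2 * Real.pi * Complex.I *
    (((Algebra.trace (ZMod p) Fq ((x % r).coeff (r.natDegree - 1))).val : ℂ) / p))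

/-- Summing `g ∘ f` over the source of an additive homomorphism weights the sum of `g` over
the range by the size of the kernel. -/
lemma sum_comp_addMonoidHom {G H M : Type*} [AddGroup G] [AddGroup H] [Fintype G] [Fintype H]
    [Semiring M] (f : G →+ H) (g : H → M) :
    ∑ x, g (f x) =
      ((Finset.univ.filter fun x => f x = 0).card : M) *
        ∑ y ∈ Finset.univ.filter (fun y => y ∈ Set.range f), g y := by
  have himage : Finset.univ.image f = Finset.univ.filter (fun y => y ∈ Set.range f) := by
    ext y; simp
  rw [Finset.sum_comp g f, himage, Finset.mul_sum]
  refine Finset.sum_congr rfl fun y hy => ?_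
  rw [nsmul_eq_mul]
  congr 2
  exact AddMonoidHom.card_fiber_eq_of_mem_range f (by simpa using hy) ⟨0, map_zero f⟩

/-- Over a finite field of odd characteristic, the quadratic Gauss sums attached to a character
and to its twist by a nonsquare cancel. -/
lemma sum_sq_add_sum_nonsquare_mul_sq {κ : Type*} [Field κ] [Fintype κ]
    (hκ : ringChar κ ≠ 2) {θ : AddChar κ ℂ} (hθ : θ ≠ 1) {u : κ} (hu : ¬ IsSquare u) :
    ∑ z, θ (z ^ 2) + ∑ z, θ (u * z ^ 2) = 0 := by
  have hu0 : u ≠ 0 := fun h => hu (h ▸ IsSquare.zero)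
  have key : ∀ g : κ → ℂ, ∑ z, g (z ^ 2) = ∑ y, ((quadraticChar κ y : ℤ) + 1 : ℂ) * g y := by
    intro g
    rw [← Finset.sum_fiberwise (s := Finset.univ) (g := fun z : κ => z ^ 2)]
    refine Finset.sum_congr rfl fun y _ => ?_
    have hcard := quadraticChar_card_sqrts hκ y
    rw [Finset.sum_congr rfl (g := fun _ => g y)
      (fun z hz => by rw [(Finset.mem_filter.1 hz).2]), Finset.sum_const, nsmul_eq_mul]
    congr 1
    have hset : (Finset.univ.filter fun z : κ => z ^ 2 = y) = {x : κ | x ^ 2 = y}.toFinset := by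
      ext; simp
    rw [hset]
    exact_mod_cast hcard
  have hχ : quadraticChar κ u = -1 := quadraticChar_neg_one_iff_not_isSquare.2 hu
  rw [key θ, key fun y => θ (u * y), ← Equiv.sum_comp (Equiv.mulLeft₀ u hu0) fun y => (_ : ℂ) * θ y, ← Finset.sum_add_distrib]
  have hterm : ∀ y, ((quadraticChar κ (u * y) : ℤ) + 1 : ℂ) * θ (u * y) +
      ((quadraticChar κ y : ℤ) + 1 : ℂ) * θ (u * y) = 2 * θ (u * y) := by
    intro y
    rw [map_mul, hχ]
    push_cast
    ring
  refine (Finset.sum_congr rfl fun y _ => hterm y).trans ?_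
  rw [← Finset.mul_sum, (mulLeft_bijective₀ u hu0).sum_comp θ, AddChar.sum_eq_zero_of_ne_one hθ,
    mul_zero]

/-- Reduction of a quadratic Gauss sum to the annihilator of an element of square zero. -/
lemma sum_sq_eq_sum_annihilator {R : Type*} [CommRing R] [Fintype R] (h2 : IsUnit (2 : R))
    {ψ : AddChar R ℂ} (hψ : ψ.IsPrimitive) {ρ : R} (hρ : ρ ^ 2 = 0) {c : R} (hc : IsUnit c) :
    ∑ b, ψ (c * b ^ 2) = ∑ b ∈ Finset.univ.filter (fun b => ρ * b = 0), ψ (c * b ^ 2) := by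
  have hR : (Fintype.card R : ℂ) ≠ 0 := by exact_mod_cast Fintype.card_ne_zero
  apply mul_left_cancel₀ hR
  have hshift : ∀ s : R, ∑ b, ψ (c * b ^ 2) =
      ∑ b, ψ (c * b ^ 2) * ψ (s * (2 * c * (ρ * b))) := by
    intro s
    rw [← Equiv.sum_comp (Equiv.addRight (ρ * s))]
    refine Finset.sum_congr rfl fun b _ => ?_
    rw [← AddChar.map_add_eq_mul, Equiv.coe_addRight]
    congr 1
    linear_combination c * s ^ 2 * hρ
  calc (Fintype.card R : ℂ) * ∑ b, ψ (c * b ^ 2) = ∑ _s : R, ∑ b, ψ (c * b ^ 2) := by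
        rw [Finset.sum_const, nsmul_eq_mul, Finset.card_univ]
    _ = ∑ s, ∑ b, ψ (c * b ^ 2) * ψ (s * (2 * c * (ρ * b))) :=
        Finset.sum_congr rfl fun s _ => hshift s
    _ = ∑ b, ψ (c * b ^ 2) * ∑ s, ψ (s * (2 * c * (ρ * b))) := by
        rw [Finset.sum_comm]
        simp only [Finset.mul_sum]
    _ = ∑ b, if ρ * b = 0 then (Fintype.card R : ℂ) * ψ (c * b ^ 2) else 0 := by
        refine Finset.sum_congr rfl fun b _ => ?_
        rw [AddChar.sum_mulShift _ hψ]
        simp only [(h2.mul hc).mul_right_eq_zero]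
        split_ifs <;> simp [mul_comm]
    _ = _ := by rw [← Finset.sum_filter, Finset.mul_sum]

/-- In a finite chain ring of odd length with uniformizer `π`, quadratic Gauss sums are
proportional to quadratic Gauss sums over the residue field. -/
lemma card_mul_sum_sq_eq {R κ : Type*} [CommRing R] [Fintype R] [Field κ] [Fintype κ]
    (h2 : IsUnit (2 : R)) {ψ : AddChar R ℂ} (hψ : ψ.IsPrimitive) {π : R} {m : ℕ}
    (hπ : π ^ (2 * m + 1) = 0) (hann : ∀ b, π ^ (m + 1) * b = 0 ↔ π ^ m ∣ b)
    {f : R →+* κ} (hf : Function.Surjective f) {c : R} (hc : IsUnit c) {θ : AddChar κ ℂ}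
    (hθ : ∀ y, θ (f y) = ψ (c * π ^ (2 * m) * y)) :
    ((Finset.univ.filter fun x => π ^ m * x = 0).card : ℂ) * ∑ b, ψ (c * b ^ 2) =
      ((Finset.univ.filter fun x => f x = 0).card : ℂ) * ∑ z, θ (z ^ 2) := by
  have hρ : (π ^ (m + 1)) ^ 2 = 0 := by
    rw [← pow_mul, show (m + 1) * 2 = 2 * m + 1 + 1 by ring, pow_succ, hπ, zero_mul]
  rw [sum_sq_eq_sum_annihilator h2 hψ hρ hc]
  have hmul := sum_comp_addMonoidHom (AddMonoidHom.mulLeft (π ^ m)) fun b => ψ (c * b ^ 2)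
  have hres := sum_comp_addMonoidHom f.toAddMonoidHom fun z => θ (z ^ 2)
  have hfilter : (Finset.univ.filter fun b : R => b ∈ Set.range (AddMonoidHom.mulLeft (π ^ m))) =
      Finset.univ.filter fun b => π ^ (m + 1) * b = 0 := by
    refine Finset.filter_congr fun b _ => ?_
    rw [hann]
    exact ⟨fun ⟨x, hx⟩ => ⟨x, hx.symm⟩, fun ⟨x, hx⟩ => ⟨x, hx.symm⟩⟩
  have huniv : (Finset.univ.filter fun z : κ => z ∈ Set.range f.toAddMonoidHom) =
      Finset.univ :=
    Finset.filter_true_of_mem fun z _ => hf z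
  rw [hfilter] at hmul
  rw [huniv] at hres
  refine hmul.symm.trans (Eq.trans ?_ hres)
  refine Finset.sum_congr rfl fun x _ => ?_
  change ψ (c * (π ^ m * x) ^ 2) = θ (f x ^ 2)
  rw [← map_pow, hθ]
  congr 1
  ring

/-- In a finite chain ring of odd length and odd residue characteristic, multiplying the
coefficient of a quadratic Gauss sum by a nonsquare unit changes its sign. -/
lemma sum_nonsquare_mul_sq_eq_neg {R κ : Type*} [CommRing R] [Fintype R] [Field κ] [Fintype κ]
    (hκ : ringChar κ ≠ 2) (h2 : IsUnit (2 : R)) {ψ : AddChar R ℂ} (hψ : ψ.IsPrimitive)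
    {π : R} {m : ℕ} (hπ0 : π ^ (2 * m) ≠ 0) (hπ : π ^ (2 * m + 1) = 0)
    (hann : ∀ b, π ^ (m + 1) * b = 0 ↔ π ^ m ∣ b)
    {f : R →+* κ} (hf : Function.Surjective f) (hker : ∀ x, f x = 0 → π ∣ x)
    {u : R} (hu : IsUnit u) (hfu : ¬ IsSquare (f u)) {c : R} (hc : IsUnit c) :
    ∑ b, ψ (u * c * b ^ 2) = -∑ b, ψ (c * b ^ 2) := by
  have hwell : ∀ x y, f x = f y → ψ (c * π ^ (2 * m) * x) = ψ (c * π ^ (2 * m) * y) := by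
    intro x y hxy
    obtain ⟨d, hd⟩ := hker (x - y) (by rw [map_sub, hxy, sub_self])
    congr 1
    linear_combination c * π ^ (2 * m) * hd + c * d * hπ
  let θ : AddChar κ ℂ :=
    { toFun := fun z => ψ (c * π ^ (2 * m) * Function.surjInv hf z)
      map_zero_eq_one' := by
        rw [hwell _ 0 (by rw [Function.surjInv_eq hf, map_zero]), mul_zero,
          AddChar.map_zero_eq_one]
      map_add_eq_mul' := fun z w => by
        rw [hwell _ (Function.surjInv hf z + Function.surjInv hf w)
          (by simp only [map_add, Function.surjInv_eq hf]), mul_add, AddChar.map_add_eq_mul] }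
  have hθ : ∀ y, θ (f y) = ψ (c * π ^ (2 * m) * y) := fun y =>
    hwell _ _ (Function.surjInv_eq hf _)
  have hθ1 : θ ≠ 1 := by
    intro h
    apply hψ (a := c * π ^ (2 * m)) (by rwa [Ne, hc.mul_right_eq_zero])
    ext y
    rw [AddChar.mulShift_apply, ← hθ, h, AddChar.one_apply, AddChar.one_apply]
  have hθu : ∀ y, θ.mulShift (f u) (f y) = ψ (u * c * π ^ (2 * m) * y) := by
    intro y
    rw [AddChar.mulShift_apply, ← map_mul, hθ]
    congr 1
    ring
  have hcard : ((Finset.univ.filter fun x => π ^ m * x = 0).card : ℂ) ≠ 0 := by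
    exact_mod_cast (Finset.card_pos.2 ⟨0, by simp⟩).ne'
  apply mul_left_cancel₀ hcard
  rw [mul_neg, card_mul_sum_sq_eq h2 hψ hπ hann hf hc hθ,
    card_mul_sum_sq_eq h2 hψ hπ hann hf (hu.mul hc) hθu, eq_neg_iff_add_eq_zero, ← mul_add,
    add_comm]
  simp only [AddChar.mulShift_apply]
  rw [sum_sq_add_sum_nonsquare_mul_sq hκ hθ1 hfu, mul_zero]

lemma AddChar.map_finsetSum {A M ι : Type*} [AddCommMonoid A] [CommMonoid M] (ψ : AddChar A M)
    (s : Finset ι) (g : ι → A) : ψ (∑ i ∈ s, g i) = ∏ i ∈ s, ψ (g i) := by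
  induction s using Finset.induction_on with
  | empty => simp
  | insert i s hi ih => rw [Finset.sum_insert hi, Finset.prod_insert hi, map_add_eq_mul, ih]

/-- If twisting by a unit `u` changes the sign of all quadratic Gauss sums, then complete
exponential sums of diagonal quadratic forms in an odd number of variables vanish. -/
lemma sum_units_diagonal_eq_zero {R : Type*} [CommRing R] [Fintype R] {ψ : AddChar R ℂ} {u : R}
    (hu : IsUnit u)
    (hsign : ∀ c, IsUnit c → ∑ b, ψ (u * c * b ^ 2) = -∑ b, ψ (c * b ^ 2))
    {n : ℕ} (hn : Odd n) (a : Fin n → R) (ha : ∀ i, IsUnit (a i)) :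
    ∑ c : Rˣ, ∑ b : Fin n → R, ψ (c * ∑ i, a i * b i ^ 2) = 0 := by
  have hprod : ∀ c : R, ∑ b : Fin n → R, ψ (c * ∑ i, a i * b i ^ 2) =
      ∏ i, ∑ b, ψ (c * a i * b ^ 2) := by
    intro c
    rw [Finset.prod_univ_sum, Fintype.piFinset_univ]
    refine Finset.sum_congr rfl fun b _ => ?_
    rw [Finset.mul_sum, AddChar.map_finsetSum]
    simp only [mul_assoc]
  simp only [hprod]
  apply self_eq_neg.1
  conv_lhs => rw [← Equiv.sum_comp (Equiv.mulLeft hu.unit)]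
  rw [← Finset.sum_neg_distrib]
  refine Finset.sum_congr rfl fun c _ => ?_
  simp only [Equiv.coe_mulLeft, Units.val_mul, IsUnit.unit_spec]
  simp only [mul_assoc u (c : R)]
  rw [Finset.prod_congr rfl fun i _ => hsign (c * a i) (c.isUnit.mul (ha i)), Finset.prod_neg,
    Finset.card_univ, Fintype.card_fin, hn.neg_one_pow, neg_one_mul]

/-- `polyPsi` as an additive character of the quotient ring. -/
noncomputable def adjoinRootChar (p : ℕ) [Fact p.Prime] {F : Type} [Field F]
    [Algebra (ZMod p) F] {r : F[X]} (hr : r.Monic) : AddChar (AdjoinRoot r) ℂ :=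
  (ZMod.stdAddChar (N := p)).compAddMonoidHom
    ((Algebra.trace (ZMod p) F).toAddMonoidHom.comp
      ((Polynomial.lcoeff F (r.natDegree - 1)).toAddMonoidHom.comp
        (AdjoinRoot.modByMonicHom hr).toAddMonoidHom))

lemma adjoinRootChar_apply (p : ℕ) [Fact p.Prime] {F : Type} [Field F]
    [Algebra (ZMod p) F] {r : F[X]} (hr : r.Monic) (y : AdjoinRoot r) :
    adjoinRootChar p hr y = ZMod.stdAddChar
      (Algebra.trace (ZMod p) F ((AdjoinRoot.modByMonicHom hr y).coeff (r.natDegree - 1))) :=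
  rfl

lemma adjoinRootChar_mk (p : ℕ) [Fact p.Prime] {F : Type} [Field F]
    [Algebra (ZMod p) F] {r : F[X]} (hr : r.Monic) (x : F[X]) :
    adjoinRootChar p hr (AdjoinRoot.mk r x) = polyPsi p r x := by
  rw [adjoinRootChar_apply, AdjoinRoot.modByMonicHom_mk, polyPsi,
    ← Polynomial.modByMonic_eq_mod _ hr]
  rw [ZMod.stdAddChar_apply, ZMod.toCircle_apply, mul_div_assoc]

lemma adjoinRootChar_isPrimitive (p : ℕ) [Fact p.Prime] {F : Type} [Field F] [Finite F]
    [Algebra (ZMod p) F] {r : F[X]} (hr : r.Monic) : (adjoinRootChar p hr).IsPrimitive := by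
  intro y hy h
  set g := AdjoinRoot.modByMonicHom hr y with hg
  have hmk : AdjoinRoot.mk r g = y := AdjoinRoot.mk_leftInverse hr y
  have hg0 : g ≠ 0 := by
    intro h0
    rw [h0, map_zero] at hmk
    exact hy hmk.symm
  have hr1 : r ≠ 1 := by
    rintro rfl
    exact hy (by rw [← hmk, AdjoinRoot.mk_eq_zero]; exact one_dvd _)
  have hdeg : g.natDegree < r.natDegree := by
    obtain ⟨x, rfl⟩ := AdjoinRoot.mk_surjective y
    rw [hg, AdjoinRoot.modByMonicHom_mk]
    exact Polynomial.natDegree_modByMonic_lt _ hr hr1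
  have : Module.Finite (ZMod p) F := Module.Finite.of_finite
  obtain ⟨e, he⟩ := Algebra.trace_surjective (ZMod p) F 1
  have hlead : g.leadingCoeff ≠ 0 := leadingCoeff_ne_zero.2 hg0
  set j := r.natDegree - 1 - g.natDegree with hj
  set s : F[X] := g * (C (e / g.leadingCoeff) * X ^ j) with hs
  have hsdeg : s.degree < r.degree := by
    rw [degree_eq_natDegree hr.ne_zero, hs, ← mul_assoc]
    refine lt_of_le_of_lt degree_le_natDegree (WithBot.coe_lt_coe.2 ?_)
    have := natDegree_mul_le (p := g * C (e / g.leadingCoeff)) (q := X ^ j)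
    have := natDegree_mul_C_le g (e / g.leadingCoeff)
    rw [natDegree_X_pow] at *
    simp only [Nat.cast_id]
    omega
  have hscoeff : s.coeff (r.natDegree - 1) = e := by
    rw [hs, ← mul_assoc, show r.natDegree - 1 = g.natDegree + j by omega, coeff_mul_X_pow,
      coeff_mul_C, coeff_natDegree, mul_div_cancel₀ _ hlead]
  have hval := DFunLike.congr_fun h (AdjoinRoot.mk r (C (e / g.leadingCoeff) * X ^ j))
  rw [AddChar.mulShift_apply, AddChar.one_apply, ← hmk, ← map_mul, adjoinRootChar_apply,
    AdjoinRoot.modByMonicHom_mk, (modByMonic_eq_self_iff hr).2 hsdeg, hscoeff, he,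
    ← (ZMod.stdAddChar (N := p)).map_zero_eq_one, ZMod.injective_stdAddChar.eq_iff] at hval
  exact one_ne_zero hval

lemma AdjoinRoot.isUnit_mk_iff {F : Type*} [Field F] {r x : F[X]} :
    IsUnit (AdjoinRoot.mk r x) ↔ IsCoprime x r := by
  rw [isUnit_iff_exists_inv]
  constructor
  · rintro ⟨y, hy⟩
    obtain ⟨y, rfl⟩ := AdjoinRoot.mk_surjective y
    rw [← map_mul, ← map_one (AdjoinRoot.mk r), AdjoinRoot.mk_eq_mk] at hy
    obtain ⟨d, hd⟩ := hy
    exact ⟨y, -d, by linear_combination hd⟩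
  · rintro ⟨y, d, hd⟩
    refine ⟨AdjoinRoot.mk r y, ?_⟩
    rw [← map_mul, ← map_one (AdjoinRoot.mk r), AdjoinRoot.mk_eq_mk]
    exact ⟨-d, by linear_combination hd⟩

lemma AdjoinRoot.mk_pow_mul_eq_zero_iff {F : Type*} [Field F] {x : F[X]} (hx : x ≠ 0)
    {i j k : ℕ} (hk : i + j = k) (b : AdjoinRoot (x ^ k)) :
    AdjoinRoot.mk (x ^ k) x ^ i * b = 0 ↔ AdjoinRoot.mk (x ^ k) x ^ j ∣ b := by
  obtain ⟨b, rfl⟩ := AdjoinRoot.mk_surjective b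
  have hdvd : x ^ k ∣ x ^ i * b ↔ x ^ j ∣ b := by
    rw [← hk, pow_add, mul_dvd_mul_iff_left (pow_ne_zero _ hx)]
  rw [← map_pow, ← map_pow, ← map_mul, AdjoinRoot.mk_eq_zero, hdvd]
  refine ⟨fun h => map_dvd (AdjoinRoot.mk (x ^ k)) h, fun ⟨y, hy⟩ => ?_⟩
  obtain ⟨y, rfl⟩ := AdjoinRoot.mk_surjective y
  rw [← map_mul, AdjoinRoot.mk_eq_mk] at hy
  exact (dvd_iff_dvd_of_dvd_sub ((pow_dvd_pow x (by omega)).trans hy)).2 (dvd_mul_right _ _)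

/-- Polynomials of degree less than `deg r` represent the classes modulo `r`. -/
lemma AdjoinRoot.bijOn_mk {F : Type*} [Field F] {r : F[X]} (hr : r.Monic) :
    Set.BijOn (AdjoinRoot.mk r) {x | x.degree < (r.natDegree : WithBot ℕ)} Set.univ := by
  rw [← degree_eq_natDegree hr.ne_zero]
  refine ⟨Set.mapsTo_univ _ _, fun x hx y hy hxy => ?_, fun y _ => ?_⟩
  · rw [← (modByMonic_eq_self_iff hr).2 hx, ← (modByMonic_eq_self_iff hr).2 hy,
      ← AdjoinRoot.modByMonicHom_mk hr, ← AdjoinRoot.modByMonicHom_mk hr, hxy]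
  · obtain ⟨x, rfl⟩ := AdjoinRoot.mk_surjective y
    refine ⟨x %ₘ r, degree_modByMonic_lt _ hr, ?_⟩
    rw [← AdjoinRoot.modByMonicHom_mk hr]
    exact AdjoinRoot.mk_leftInverse hr _

/-- The exponential sum over residue representatives as a sum over the quotient ring. -/
lemma finsum_polyPsi_eq (p : ℕ) [Fact p.Prime] {F : Type} [Field F] [Algebra (ZMod p) F]
    {r : F[X]} (hr : r.Monic) [Fintype (AdjoinRoot r)] {n : ℕ} (a : Fin n → F) :
    (∑ᶠ c ∈ {c : F[X] | c.degree < ((r.natDegree : ℕ) : WithBot ℕ) ∧ IsCoprime c r},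
      ∑ᶠ b ∈ {b : Fin n → F[X] | ∀ i, (b i).degree < ((r.natDegree : ℕ) : WithBot ℕ)},
        polyPsi p r (c * ∑ i, C (a i) * b i ^ 2)) =
      ∑ c : (AdjoinRoot r)ˣ, ∑ b : Fin n → AdjoinRoot r,
        adjoinRootChar p hr (c * ∑ i, AdjoinRoot.of r (a i) * b i ^ 2) := by
  have hbij := AdjoinRoot.bijOn_mk hr
  have hinner : ∀ c : F[X],
      (∑ᶠ b ∈ {b : Fin n → F[X] | ∀ i, (b i).degree < ((r.natDegree : ℕ) : WithBot ℕ)},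
        polyPsi p r (c * ∑ i, C (a i) * b i ^ 2)) = ∑ b : Fin n → AdjoinRoot r,
        adjoinRootChar p hr (AdjoinRoot.mk r c * ∑ i, AdjoinRoot.of r (a i) * b i ^ 2) := by
    intro c
    rw [← finsum_eq_sum_of_fintype]
    refine Eq.trans ?_ (finsum_mem_univ _)
    refine finsum_mem_eq_of_bijOn
      (fun (b : Fin n → F[X]) i => AdjoinRoot.mk r (b i))
      ⟨Set.mapsTo_univ _ _, fun b hb b' hb' h => ?_, fun y _ => ?_⟩ fun b _ => ?_
    · exact funext fun i => hbij.injOn (hb i) (hb' i) (congrFun h i)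
    · choose b hb hby using fun i => hbij.surjOn (Set.mem_univ (y i))
      exact ⟨b, hb, funext hby⟩
    · rw [← adjoinRootChar_mk p hr]
      simp only [map_mul, map_sum, map_pow, AdjoinRoot.mk_C]
  simp only [hinner]
  rw [← finsum_eq_sum_of_fintype]
  set G : AdjoinRoot r → ℂ := fun c => ∑ b : Fin n → AdjoinRoot r,
    adjoinRootChar p hr (c * ∑ i, AdjoinRoot.of r (a i) * b i ^ 2) with hG
  have hunits : ∑ᶠ c : (AdjoinRoot r)ˣ, G c = ∑ᶠ c ∈ {c : AdjoinRoot r | IsUnit c}, G c :=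
    (finsum_mem_range (f := G) Units.val_injective).symm
  refine Eq.trans ?_ hunits.symm
  refine finsum_mem_eq_of_bijOn (AdjoinRoot.mk r)
    ⟨fun c hc => AdjoinRoot.isUnit_mk_iff.2 hc.2, hbij.injOn.mono fun c hc => hc.1,
      fun y hy => ?_⟩ fun c _ => rfl
  obtain ⟨c, hc, rfl⟩ := hbij.surjOn (Set.mem_univ y)
  exact ⟨c, ⟨hc, AdjoinRoot.isUnit_mk_iff.1 hy⟩, rfl⟩

/-- Let `q` be a power of an odd prime `p`, `n` odd positive, and
`f = a₁X₁² + ⋯ + a_nX_n²` with `a_i ∈ 𝔽_q^×`. For `ϖ` monic irreducible and odd `k ≥ 1`,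
the complete exponential sum
`S_{ϖ^k}(f) = Σ_{a coprime to ϖ^k, deg a < k·deg ϖ} Σ_{b, deg b_i < k·deg ϖ} ψ(a f(b)/ϖ^k)`
vanishes. -/
theorem exp_sum_odd_vanishes (p : ℕ) [Fact p.Prime] (hp : p ≠ 2)
    (Fq : Type) [Field Fq] [Fintype Fq] [Algebra (ZMod p) Fq]
    (n : ℕ) (hn : 0 < n) (hnodd : Odd n) (a : Fin n → Fq) (ha : ∀ i, a i ≠ 0)
    (ϖ : Polynomial Fq) (hmonic : ϖ.Monic) (hirr : Irreducible ϖ)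
    (k : ℕ) (hk : 1 ≤ k) (hkodd : Odd k) :
    (∑ᶠ c ∈ {c : Polynomial Fq |
        c.degree < (((ϖ ^ k).natDegree : ℕ) : WithBot ℕ) ∧ IsCoprime c (ϖ ^ k)},
      ∑ᶠ b ∈ {b : Fin n → Polynomial Fq |
          ∀ i, (b i).degree < (((ϖ ^ k).natDegree : ℕ) : WithBot ℕ)},
        polyPsi p (ϖ ^ k) (c * ∑ i, Polynomial.C (a i) * b i ^ 2)) = 0 := by
  obtain ⟨m, rfl⟩ := hkodd
  have hr : (ϖ ^ (2 * m + 1)).Monic := hmonic.pow _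
  have : Fact (Irreducible ϖ) := ⟨hirr⟩
  have : Module.Finite Fq (AdjoinRoot (ϖ ^ (2 * m + 1))) := hr.finite_adjoinRoot
  have : Module.Finite Fq (AdjoinRoot ϖ) := hmonic.finite_adjoinRoot
  have : Finite (AdjoinRoot (ϖ ^ (2 * m + 1))) := Module.finite_of_finite Fq
  have : Finite (AdjoinRoot ϖ) := Module.finite_of_finite Fq
  have := Fintype.ofFinite (AdjoinRoot (ϖ ^ (2 * m + 1)))
  have := Fintype.ofFinite (AdjoinRoot ϖ)
  have : CharP Fq p := charP_of_injective_algebraMap (algebraMap (ZMod p) Fq).injective p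
  have : CharP (AdjoinRoot ϖ) p :=
    charP_of_injective_algebraMap (algebraMap Fq (AdjoinRoot ϖ)).injective p
  have hκ : ringChar (AdjoinRoot ϖ) ≠ 2 := by rwa [ringChar.eq (AdjoinRoot ϖ) p]
  have h2 : (2 : Fq) ≠ 0 := Ring.two_ne_zero (by rwa [ringChar.eq Fq p])
  rw [finsum_polyPsi_eq p hr a]
  set f : AdjoinRoot (ϖ ^ (2 * m + 1)) →+* AdjoinRoot ϖ :=
    AdjoinRoot.lift (AdjoinRoot.of ϖ) (AdjoinRoot.root ϖ)
      (by rw [eval₂_pow, AdjoinRoot.eval₂_root, zero_pow (Nat.succ_ne_zero _)])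
  have hfmk : ∀ x, f (AdjoinRoot.mk _ x) = AdjoinRoot.mk ϖ x := fun x =>
    (AdjoinRoot.lift_mk _ x).trans (AdjoinRoot.aeval_eq x)
  have hf : Function.Surjective f := fun z => by
    obtain ⟨x, rfl⟩ := AdjoinRoot.mk_surjective z
    exact ⟨_, hfmk x⟩
  obtain ⟨z, hz⟩ := FiniteField.exists_nonsquare hκ
  obtain ⟨x, rfl⟩ := AdjoinRoot.mk_surjective z
  have hx : ¬ ϖ ∣ x := fun h => hz (by rw [AdjoinRoot.mk_eq_zero.2 h]; exact IsSquare.zero)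
  have hu : IsUnit (AdjoinRoot.mk (ϖ ^ (2 * m + 1)) x) :=
    AdjoinRoot.isUnit_mk_iff.2 ((hirr.coprime_iff_not_dvd.2 hx).symm.pow_right)
  refine sum_units_diagonal_eq_zero hu (fun c hc => ?_) hnodd _
    fun i => (isUnit_iff_ne_zero.2 (ha i)).map _
  refine sum_nonsquare_mul_sq_eq_neg (π := AdjoinRoot.mk _ ϖ) (m := m) (f := f) hκ ?_
    (adjoinRootChar_isPrimitive p hr) ?_ ?_ ?_ hf ?_ hu (by rwa [hfmk]) hc
  · rw [← map_ofNat (AdjoinRoot.of (ϖ ^ (2 * m + 1))) 2]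
    exact (isUnit_iff_ne_zero.2 h2).map _
  · rw [← map_pow, Ne, AdjoinRoot.mk_eq_zero, pow_dvd_pow_iff hirr.ne_zero hirr.not_isUnit]
    omega
  · rw [← map_pow, AdjoinRoot.mk_self]
  · exact AdjoinRoot.mk_pow_mul_eq_zero_iff hirr.ne_zero (by omega)
  · intro y hy
    obtain ⟨y, rfl⟩ := AdjoinRoot.mk_surjective y
    rw [hfmk, AdjoinRoot.mk_eq_zero] at hy
    exact map_dvd (AdjoinRoot.mk (ϖ ^ (2 * m + 1))) hy
end

section
/- Let q be a power of an odd prime, n an even positive integer, f = a_1X_1² + ⋯ + a_nX_n² with a_i ∈ 𝔽_q^×, and r ∈ 𝔽_q[t] monic. Then S_r(f) := Σ_{a coprime to r, deg a < deg r} Σ_{b ∈ 𝔽_q[t]^n, deg b_i < deg r} ψ(a f(b)/r) equals ((−1)^{n/2} a_1⋯a_n / r) · φ(r) · q^{(n/2)·deg(r)}, where (·/r) is the Jacobi symbol and φ the polynomial totient function. -/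
open Polynomial
open scoped Classical

/-- The Legendre symbol `(a/ϖ)` on `𝔽_q[t]` for `ϖ` irreducible. -/
noncomputable def polyLegendre {Fq : Type} [Field Fq] (a ϖ : Polynomial Fq) : ℤ :=
  if Ideal.Quotient.mk (Ideal.span {ϖ}) a = 0 then 0
  else if IsSquare (Ideal.Quotient.mk (Ideal.span {ϖ}) a) then 1 else -1

/-- The Jacobi symbol `(a/r)` on `𝔽_q[t]`. -/
noncomputable def polyJacobi {Fq : Type} [Field Fq] (a r : Polynomial Fq) : ℤ :=
  ((UniqueFactorizationMonoid.normalizedFactors r).map (polyLegendre a)).prod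

/-- Euler's totient function on `𝔽_q[t]`: the number of units of `𝔽_q[t]/(r)`. -/
noncomputable def polyPhi {Fq : Type} [Field Fq] (r : Polynomial Fq) : ℕ :=
  Nat.card (Polynomial Fq ⧸ Ideal.span {r})ˣ

theorem AddChar.map_finset_sum_eq_prod {A M ι : Type*} [AddCommMonoid A] [CommMonoid M]
    (ψ : AddChar A M) (s : Finset ι) (f : ι → A) : ψ (∑ i ∈ s, f i) = ∏ i ∈ s, ψ (f i) :=
  map_sum ψ.toAddMonoidHom f s

section QuadraticCharacter

variable {F : Type*} [Field F] [Fintype F]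

/-- A scalar `α ≠ 0` of a finite field becomes a square in an extension of degree `k` if and only
if the `k`-th power of its quadratic character is `1`. -/
theorem isSquare_algebraMap_iff_quadraticChar_pow {K : Type*} [Field K] [Algebra F K]
    [FiniteDimensional F K] (hF : ringChar F ≠ 2) {α : F} (hα : α ≠ 0) :
    IsSquare (algebraMap F K α) ↔ quadraticChar F α ^ Module.finrank F K = 1 := by
  have : Finite K := Module.finite_of_finite F
  let _ : Fintype K := Fintype.ofFinite K
  have hK : ringChar K ≠ 2 := by rwa [← Algebra.ringChar_eq F K]
  obtain ⟨h, hh⟩ : ∃ h, Fintype.card F = 2 * h + 1 :=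
    ⟨Fintype.card F / 2, by have := FiniteField.odd_card_of_char_ne_two hF; omega⟩
  set k := Module.finrank F K
  set e := quadraticChar F α with he
  have hpow : ((e : ℤ) : F) = α ^ h := by
    rw [he, quadraticChar_eq_pow_of_char_ne_two' hF, hh]
    congr 1
    omega
  have hcard : Fintype.card K / 2 = h * ∑ i ∈ Finset.range k, (2 * h + 1) ^ i := by
    rw [Module.card_eq_pow_finrank (K := F) (V := K), hh, ← geom_sum_mul_add]
    have : (∑ i ∈ Finset.range k, (2 * h + 1) ^ i) * (2 * h) =
      2 * (h * ∑ i ∈ Finset.range k, (2 * h + 1) ^ i) := by ring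
    change (_ + 1) / 2 = _
    rw [this]
    omega
  have hes : e ^ ∑ i ∈ Finset.range k, (2 * h + 1) ^ i = e ^ k := by
    have key : ∀ i, e ^ (2 * h + 1) ^ i = e := by
      have hodd : ∀ i, Odd ((2 * h + 1) ^ i) := fun i => Odd.pow ⟨h, rfl⟩
      intro i
      rcases quadraticChar_dichotomy hα with h1 | h1
      · rw [he, h1, one_pow]
      · rw [he, h1, (hodd i).neg_one_pow]
    rw [← Finset.prod_pow_eq_pow_sum, Finset.prod_congr rfl fun i _ => key i]
    simp
  have hαK : algebraMap F K α ≠ 0 := by simpa using hα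
  rw [FiniteField.isSquare_iff hK hαK, hcard, pow_mul, ← map_pow, ← hpow, map_intCast,
    ← Int.cast_pow, hes]
  have hdich : e ^ k = 1 ∨ e ^ k = -1 := by
    rcases quadraticChar_dichotomy hα with h1 | h1
    · left; rw [he, h1, one_pow]
    · rw [he, h1]; exact neg_one_pow_eq_or ℤ k
  rcases hdich with h1 | h1
  · simp [h1]
  · rw [h1]
    simpa using Ring.neg_one_ne_one_of_char_ne_two hK

/-- The one-variable quadratic exponential sum over a finite field of odd characteristic. -/
theorem sum_addChar_mul_sq_eq_quadraticChar_mul_gaussSum (hF : ringChar F ≠ 2)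
    {ψ : AddChar F ℂ} (hψ : ψ ≠ 1) {u : F} (hu : u ≠ 0) :
    ∑ x, ψ (u * x ^ 2) = (quadraticChar F u : ℂ) *
      gaussSum ((quadraticChar F).ringHomComp (Int.castRingHom ℂ)) ψ := by
  set χ := (quadraticChar F).ringHomComp (Int.castRingHom ℂ) with hχ
  have hshift := gaussSum_mulShift χ ψ (Units.mk0 u hu)
  have hχu : χ u = (quadraticChar F u : ℂ) := rfl
  have hsq : (quadraticChar F u : ℂ) * quadraticChar F u = 1 := by
    rw [← sq]
    exact_mod_cast quadraticChar_sq_one hu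
  have hprim := AddChar.IsPrimitive.of_ne_one hψ
  have hzero : ∑ y, ψ (u * y) = 0 := by
    have := AddChar.sum_eq_zero_of_ne_one (hprim hu)
    simpa [AddChar.mulShift_apply] using this
  have hfib : ∑ x, ψ (u * x ^ 2) = ∑ y, ((quadraticChar F y : ℂ) + 1) * ψ (u * y) := by
    rw [← Finset.sum_fiberwise Finset.univ (fun x : F => x ^ 2)]
    refine Finset.sum_congr rfl fun y _ => ?_
    rw [Finset.sum_congr rfl (g := fun _ => ψ (u * y))
      (fun x hx => by rw [(Finset.mem_filter.1 hx).2]), Finset.sum_const, nsmul_eq_mul]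
    congr 1
    have := quadraticChar_card_sqrts hF y
    rw [Set.toFinset_ofPred] at this
    exact_mod_cast this
  rw [hfib]
  simp only [add_mul, one_mul, Finset.sum_add_distrib, hzero, add_zero]
  rw [← hshift, Units.val_mk0, hχu, ← mul_assoc, hsq, one_mul]
  rfl

theorem gaussSum_quadraticChar_sq (hF : ringChar F ≠ 2) {ψ : AddChar F ℂ} (hψ : ψ ≠ 1) :
    gaussSum ((quadraticChar F).ringHomComp (Int.castRingHom ℂ)) ψ ^ 2 =
      (quadraticChar F (-1) : ℂ) * Fintype.card F := by
  rw [gaussSum_sq _ ((quadraticChar_isQuadratic F).comp _) (AddChar.IsPrimitive.of_ne_one hψ)]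
  · rfl
  · rw [Ne, MulChar.ringHomComp_eq_one_iff Int.cast_injective]
    exact quadraticChar_ne_one hF

/-- The exponential sum of a sum of an even number of multiples of a nondegenerate quadratic form
over a finite field of odd characteristic. -/
theorem prod_sum_addChar_mul_quadraticForm {V : Type*} [AddCommGroup V] [Module F V] [Fintype V]
    (hF : ringChar F ≠ 2) {ψ : AddChar F ℂ} (hψ : ψ ≠ 1) (B : LinearMap.BilinForm F V)
    (hsymm : ∀ x y, B x y = B y x) (hB : B.SeparatingLeft)
    {n : ℕ} (hn : Even n) (a : Fin n → F) (ha : ∀ i, a i ≠ 0) :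
    ∏ i, ∑ v, ψ (a i * B v v) =
      (quadraticChar F ((-1) ^ (n / 2) * ∏ i, a i) : ℂ) ^ Module.finrank F V *
        (Fintype.card F : ℂ) ^ ((n / 2) * Module.finrank F V) := by
  let _ : Invertible (2 : F) := invertibleOfNonzero (Ring.two_ne_zero hF)
  have hassoc : QuadraticMap.associated B.toQuadraticMap = B :=
    QuadraticMap.associated_left_inverse F hsymm
  obtain ⟨w, ⟨E⟩⟩ := QuadraticForm.equivalent_weightedSumSquares_units_of_nondegenerate'
    B.toQuadraticMap (by rwa [hassoc])
  let d := Module.finrank F V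
  set g := gaussSum ((quadraticChar F).ringHomComp (Int.castRingHom ℂ)) ψ
  have hsum : ∀ i, ∑ v, ψ (a i * B v v) =
      (quadraticChar F (a i) : ℂ) ^ d * ((∏ j, (quadraticChar F (w j) : ℂ)) * g ^ d) := by
    intro i
    have h1 : ∑ v, ψ (a i * B v v) =
        ∑ x : Fin d → F, ∏ j, ψ (a i * w j * x j ^ 2) := by
      refine Fintype.sum_equiv E.toLinearEquiv.toEquiv _ _ fun v => ?_
      have h2 : B v v = ∑ j, (w j : F) * (E v j) ^ 2 := by
        have := E.map_app v
        rw [QuadraticMap.weightedSumSquares_apply, LinearMap.BilinMap.toQuadraticMap_apply] at this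
        rw [← this]
        exact Finset.sum_congr rfl fun j _ => by rw [Units.smul_def, smul_eq_mul, sq]
      rw [h2, Finset.mul_sum, AddChar.map_finset_sum_eq_prod]
      exact Finset.prod_congr rfl fun j _ => by rw [← mul_assoc]; rfl
    rw [h1, ← Fintype.piFinset_univ, ← Finset.prod_univ_sum (fun _ => Finset.univ)
      (fun j y => ψ (a i * w j * y ^ 2))]
    rw [Finset.prod_congr rfl fun j _ => sum_addChar_mul_sq_eq_quadraticChar_mul_gaussSum hF hψ
      (mul_ne_zero (ha i) (w j).ne_zero)]
    simp only [map_mul, Int.cast_mul, Finset.prod_mul_distrib, Finset.prod_const,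
      Finset.card_univ, Fintype.card_fin, mul_assoc, d, g]
  have hw : (∏ j, (quadraticChar F (w j) : ℂ)) ^ 2 = 1 := by
    rw [← Finset.prod_pow]
    exact Finset.prod_eq_one fun j _ => mod_cast quadraticChar_sq_one (w j).ne_zero
  obtain ⟨m, rfl⟩ := hn
  have hm : (m + m) / 2 = m := by omega
  have hpair : ((∏ j, (quadraticChar F (w j) : ℂ)) * g ^ d) ^ (m + m) =
      (((quadraticChar F (-1) : ℂ) * Fintype.card F) ^ d) ^ m := by
    rw [← two_mul, pow_mul, mul_pow, hw, one_mul, pow_right_comm g,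
      gaussSum_quadraticChar_sq hF hψ]
  rw [Finset.prod_congr rfl fun i _ => hsum i, Finset.prod_mul_distrib, Finset.prod_const,
    Finset.card_univ, Fintype.card_fin, hm, hpair, Finset.prod_pow,
    map_mul, map_pow, map_prod]
  push_cast
  ring

end QuadraticCharacter

section Jacobi

variable {Fq : Type} [Field Fq] [Fintype Fq]

theorem polyLegendre_C (hF : ringChar Fq ≠ 2) {α : Fq} (hα : α ≠ 0) {ϖ : Fq[X]}
    (hϖ : Irreducible ϖ) : polyLegendre (C α) ϖ = quadraticChar Fq α ^ ϖ.natDegree := by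
  have : (Ideal.span {ϖ}).IsMaximal := PrincipalIdealRing.isMaximal_of_irreducible hϖ
  let _ : Field (Fq[X] ⧸ Ideal.span {ϖ}) := Ideal.Quotient.field _
  have hfin : Module.finrank Fq (Fq[X] ⧸ Ideal.span {ϖ}) = ϖ.natDegree :=
    finrank_quotient_span_eq_natDegree
  have : FiniteDimensional Fq (Fq[X] ⧸ Ideal.span {ϖ}) :=
    FiniteDimensional.of_finrank_pos (hfin ▸ hϖ.natDegree_pos)
  have hmk : Ideal.Quotient.mk (Ideal.span {ϖ}) (C α) =
    algebraMap Fq (Fq[X] ⧸ Ideal.span {ϖ}) α := rfl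
  have hne : algebraMap Fq (Fq[X] ⧸ Ideal.span {ϖ}) α ≠ 0 := by simpa using hα
  have hsq := isSquare_algebraMap_iff_quadraticChar_pow (K := Fq[X] ⧸ Ideal.span {ϖ}) hF hα
  rw [hfin] at hsq
  have hdich : quadraticChar Fq α ^ ϖ.natDegree = 1 ∨ quadraticChar Fq α ^ ϖ.natDegree = -1 := by
    rcases quadraticChar_dichotomy hα with h1 | h1
    · left; rw [h1, one_pow]
    · rw [h1]; exact neg_one_pow_eq_or ℤ _
  rw [polyLegendre, hmk, if_neg hne]
  split_ifs with h
  · exact (hsq.1 h).symm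
  · exact (hdich.resolve_left fun h' => h (hsq.2 h')).symm

theorem polyJacobi_C (hF : ringChar Fq ≠ 2) {α : Fq} (hα : α ≠ 0) {r : Fq[X]} (hr : r ≠ 0) :
    polyJacobi (C α) r = quadraticChar Fq α ^ r.natDegree := by
  have key : ∀ s : Multiset Fq[X], (∀ ϖ ∈ s, Irreducible ϖ) →
      (s.map (polyLegendre (C α))).prod = quadraticChar Fq α ^ s.prod.natDegree := by
    intro s
    induction s using Multiset.induction_on with
    | empty => simp
    | cons ϖ s ih =>
      intro hs
      have hs' : ∀ ϖ ∈ s, Irreducible ϖ := fun x hx => hs x (Multiset.mem_cons_of_mem hx)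
      have hϖ := hs ϖ (Multiset.mem_cons_self _ _)
      have hprod : s.prod ≠ 0 := Multiset.prod_ne_zero fun h0 => (hs' 0 h0).ne_zero rfl
      rw [Multiset.map_cons, Multiset.prod_cons, Multiset.prod_cons, ih hs',
        natDegree_mul hϖ.ne_zero hprod, pow_add, polyLegendre_C hF hα hϖ]
  rw [polyJacobi, key _ fun ϖ h => UniqueFactorizationMonoid.irreducible_of_normalized_factor ϖ h,
    natDegree_eq_of_degree_eq
      (degree_eq_degree_of_associated (UniqueFactorizationMonoid.prod_normalizedFactors hr))]

end Jacobi

theorem finite_degree_lt {F : Type*} [Field F] [Finite F] (d : ℕ) :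
    {c : F[X] | c.degree < (d : WithBot ℕ)}.Finite := by
  have : Finite (degreeLT F d) := Finite.of_equiv _ (degreeLTEquiv F d).symm.toEquiv
  exact (degreeLT F d : Set F[X]).toFinite.subset fun c hc => mem_degreeLT.2 hc

/-- The reduced residues of degree less than `deg r` are counted by Euler's totient function. -/
theorem ncard_reduced_residues_eq_polyPhi {F : Type} [Field F] {r : F[X]} (hr : r.Monic) :
    {c : F[X] | c.degree < ((r.natDegree : ℕ) : WithBot ℕ) ∧ IsCoprime c r}.ncard =
      polyPhi r := by
  have hdeg : r.degree = ((r.natDegree : ℕ) : WithBot ℕ) := degree_eq_natDegree hr.ne_zero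
  have hunit : ∀ c : F[X], IsUnit (Ideal.Quotient.mk (Ideal.span {r}) c) ↔ IsCoprime c r := by
    intro c
    rw [isUnit_iff_exists_inv]
    constructor
    · rintro ⟨b, hb⟩
      obtain ⟨b, rfl⟩ := Ideal.Quotient.mk_surjective b
      rw [← map_mul, ← map_one (Ideal.Quotient.mk (Ideal.span {r})), eq_comm,
        Ideal.Quotient.eq, Ideal.mem_span_singleton] at hb
      obtain ⟨k, hk⟩ := hb
      exact ⟨b, k, by linear_combination -hk⟩
    · rintro ⟨b, k, h⟩
      refine ⟨Ideal.Quotient.mk _ b, ?_⟩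
      rw [← map_mul, ← map_one (Ideal.Quotient.mk (Ideal.span {r})), eq_comm,
        Ideal.Quotient.eq, Ideal.mem_span_singleton]
      exact ⟨k, by linear_combination -h⟩
  have hcard : polyPhi r = {x : F[X] ⧸ Ideal.span {r} | IsUnit x}.ncard := by
    rw [polyPhi, ← Nat.card_coe_set_eq]
    exact Nat.card_congr (Equiv.ofInjective _ Units.val_injective)
  rw [hcard]
  refine Set.ncard_congr (fun c _ => Ideal.Quotient.mk _ c) (fun c hc => (hunit c).2 hc.2) ?_ ?_
  · intro c c' hc hc' h
    rw [Ideal.Quotient.eq, Ideal.mem_span_singleton] at h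
    exact sub_eq_zero.1 (eq_zero_of_dvd_of_degree_lt h
      (lt_of_le_of_lt (degree_sub_le _ _) (hdeg ▸ max_lt hc.1 hc'.1)))
  · intro x hx
    obtain ⟨c, rfl⟩ := Ideal.Quotient.mk_surjective x
    have hmod : Ideal.Quotient.mk (Ideal.span {r}) (c % r) = Ideal.Quotient.mk _ c := by
      rw [eq_comm, Ideal.Quotient.eq, Ideal.mem_span_singleton]
      exact ⟨c / r, by linear_combination -(EuclideanDomain.div_add_mod c r)⟩
    refine ⟨c % r, ⟨hdeg ▸ EuclideanDomain.mod_lt c hr.ne_zero, ?_⟩, hmod⟩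
    rw [← hunit, hmod]
    exact hx

section ResidueForm

variable {F : Type*} [Field F]

/-- The linear form taking `x` to the coefficient of `t^{deg r - 1}` in `x mod r`. -/
noncomputable def residueForm (r : F[X]) : F[X] →ₗ[F] F :=
  lcoeff F (r.natDegree - 1) ∘ₗ modByMonicHom r

/-- The bilinear form `(x, y) ↦ res(c x y / r)` on polynomials of degree less than `deg r`. -/
noncomputable def residueBilinForm (r c : F[X]) :
    LinearMap.BilinForm F (degreeLT F r.natDegree) :=
  (((LinearMap.mul F F[X]).compr₂ (residueForm r ∘ₗ LinearMap.mulLeft F c)).domRestrict₁₂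
    (degreeLT F r.natDegree) (degreeLT F r.natDegree))

theorem residueForm_apply {r : F[X]} (hr : r.Monic) (x : F[X]) :
    residueForm r x = (x % r).coeff (r.natDegree - 1) := by
  simp [residueForm, modByMonicHom, modByMonic_eq_mod x hr]

theorem residueBilinForm_apply (r c : F[X]) (x y : degreeLT F r.natDegree) :
    residueBilinForm r c x y = residueForm r (c * (x * y)) := rfl

theorem residueBilinForm_separatingLeft {r c : F[X]} (hr : r.Monic) (hc : IsCoprime c r) :
    (residueBilinForm r c).SeparatingLeft := by
  have hdeg : r.degree = ((r.natDegree : ℕ) : WithBot ℕ) := degree_eq_natDegree hr.ne_zero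
  rintro ⟨x, hx⟩ h
  rw [mem_degreeLT, ← hdeg] at hx
  by_contra hx0
  replace hx0 : x ≠ 0 := fun h0 => hx0 (Subtype.ext h0)
  set z := (c * x) % r with hz
  have hz0 : z ≠ 0 := fun h0 =>
    hx0 (eq_zero_of_dvd_of_degree_lt (hc.symm.dvd_of_dvd_mul_left
      (EuclideanDomain.mod_eq_zero.1 h0)) hx)
  have hzr : z.degree < r.degree := EuclideanDomain.mod_lt _ hr.ne_zero
  have hzn : z.natDegree < r.natDegree := natDegree_lt_natDegree hz0 hzr
  set k := r.natDegree - 1 - z.natDegree with hk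
  have hXk : (X ^ k : F[X]) ∈ degreeLT F r.natDegree := by
    rw [mem_degreeLT, degree_X_pow]
    exact_mod_cast (by omega : k < r.natDegree)
  have hmod : (c * (x * X ^ k)) % r = z * X ^ k := by
    have h1 : (z * X ^ k) % r = z * X ^ k := by
      rw [mod_eq_self_iff hr.ne_zero, hdeg, degree_mul, degree_X_pow, degree_eq_natDegree hz0]
      exact_mod_cast (by omega : z.natDegree + k < r.natDegree)
    rw [← h1, ← mul_assoc, ← modByMonic_eq_mod _ hr, ← modByMonic_eq_mod _ hr,
      ← sub_eq_zero, ← sub_modByMonic, modByMonic_eq_zero_iff_dvd hr, ← sub_mul]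
    refine Dvd.dvd.mul_right ⟨c * x / r, ?_⟩ _
    linear_combination -(EuclideanDomain.div_add_mod (c * x) r)
  have hval := h ⟨X ^ k, hXk⟩
  rw [residueBilinForm_apply, residueForm_apply hr, hmod,
    show r.natDegree - 1 = z.natDegree + k by omega, coeff_mul_X_pow] at hval
  exact hz0 (leadingCoeff_eq_zero.1 hval)

end ResidueForm

/-- The additive character `a ↦ exp(2πi·Tr(a)/p)` of a finite field of characteristic `p`. -/
noncomputable def traceAddChar (p : ℕ) [Fact p.Prime] (F : Type*) [Field F]
    [Algebra (ZMod p) F] : AddChar F ℂ :=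
  ZMod.stdAddChar.compAddMonoidHom (Algebra.trace (ZMod p) F).toAddMonoidHom

theorem traceAddChar_ne_one (p : ℕ) [Fact p.Prime] (F : Type*) [Field F] [Finite F]
    [Algebra (ZMod p) F] : traceAddChar p F ≠ 1 := by
  obtain ⟨x, hx⟩ := Algebra.trace_surjective (ZMod p) F 1
  intro h
  have h1 : ZMod.stdAddChar (Algebra.trace (ZMod p) F x) = (1 : ℂ) := DFunLike.congr_fun h x
  rw [hx, ← AddChar.map_zero_eq_one (ZMod.stdAddChar (N := p))] at h1
  exact one_ne_zero (ZMod.injective_stdAddChar h1)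

theorem polyPsi_eq_traceAddChar (p : ℕ) [Fact p.Prime] {F : Type} [Field F]
    [Algebra (ZMod p) F] {r : F[X]} (hr : r.Monic) (x : F[X]) :
    polyPsi p r x = traceAddChar p F (residueForm r x) := by
  rw [residueForm_apply hr, traceAddChar, AddChar.compAddMonoidHom_apply, ZMod.stdAddChar_apply,
    ZMod.toCircle_apply, polyPsi, mul_div_assoc]
  rfl

/-- The complete exponential sum of a diagonal quadratic form twisted by a unit modulo `r`. -/
theorem finsum_polyPsi_diagonal (p : ℕ) [Fact p.Prime] (hp : p ≠ 2) {F : Type} [Field F]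
    [Fintype F] [Algebra (ZMod p) F] {n : ℕ} (hn : Even n) (a : Fin n → F)
    (ha : ∀ i, a i ≠ 0) {r c : F[X]} (hr : r.Monic) (hc : IsCoprime c r) :
    ∑ᶠ b ∈ {b : Fin n → F[X] | ∀ i, (b i).degree < ((r.natDegree : ℕ) : WithBot ℕ)},
        polyPsi p r (c * ∑ i, C (a i) * b i ^ 2) =
      (polyJacobi (C ((-1) ^ (n / 2) * ∏ i, a i)) r : ℂ) *
        (Fintype.card F : ℂ) ^ ((n / 2) * r.natDegree) := by
  have : CharP F p := charP_of_injective_algebraMap (algebraMap (ZMod p) F).injective p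
  have hF : ringChar F ≠ 2 := by rwa [ringChar.eq F p]
  have hne : (-1) ^ (n / 2) * ∏ i, a i ≠ 0 :=
    mul_ne_zero (pow_ne_zero _ (neg_ne_zero.2 one_ne_zero)) (Finset.prod_ne_zero_iff.2
      fun i _ => ha i)
  let e := degreeLTEquiv F r.natDegree
  let _ : Fintype (degreeLT F r.natDegree) := Fintype.ofEquiv _ e.symm.toEquiv
  have hrank : Module.finrank F (degreeLT F r.natDegree) = r.natDegree := by
    rw [e.finrank_eq, Module.finrank_fin_fun]
  have hrange : {b : Fin n → F[X] | ∀ i, (b i).degree < ((r.natDegree : ℕ) : WithBot ℕ)} =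
      Set.range fun (v : Fin n → degreeLT F r.natDegree) i => (v i : F[X]) := by
    ext b
    refine ⟨fun hb => ⟨fun i => ⟨b i, mem_degreeLT.2 (hb i)⟩, rfl⟩, ?_⟩
    rintro ⟨v, rfl⟩ i
    exact mem_degreeLT.1 (v i).2
  have hinj : Function.Injective fun (v : Fin n → degreeLT F r.natDegree) i => (v i : F[X]) :=
    fun v v' h => funext fun i => Subtype.ext (congrFun h i)
  have hterm : ∀ v : Fin n → degreeLT F r.natDegree,
      polyPsi p r (c * ∑ i, C (a i) * (v i : F[X]) ^ 2) =
        ∏ i, traceAddChar p F (a i * residueBilinForm r c (v i) (v i)) := by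
    intro v
    rw [polyPsi_eq_traceAddChar p hr, ← AddChar.map_finset_sum_eq_prod, Finset.mul_sum, map_sum]
    congr 1
    refine Finset.sum_congr rfl fun i _ => ?_
    rw [residueBilinForm_apply, ← smul_eq_mul (a i), ← map_smul, smul_eq_C_mul]
    congr 1
    ring
  rw [hrange, finsum_mem_range hinj, finsum_eq_sum_of_fintype,
    Finset.sum_congr rfl fun v _ => hterm v, ← Fintype.piFinset_univ,
    ← Finset.prod_univ_sum (fun _ => Finset.univ)
      (fun i v => traceAddChar p F (a i * residueBilinForm r c v v)),
    prod_sum_addChar_mul_quadraticForm hF (traceAddChar_ne_one p F) (residueBilinForm r c)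
      (fun x y => by rw [residueBilinForm_apply, residueBilinForm_apply, mul_comm (x : F[X])])
      (residueBilinForm_separatingLeft hr hc) hn a ha,
    hrank, polyJacobi_C hF hne hr.ne_zero, Int.cast_pow]

/-- Let `q` be a power of an odd prime `p`, `n` even positive, and
`f = a₁X₁² + ⋯ + a_nX_n²` with `a_i ∈ 𝔽_q^×`. For `r` monic,
`S_r(f) = Σ_{a coprime to r, deg a < deg r} Σ_{b, deg b_i < deg r} ψ(a f(b)/r)`
equals `((-1)^{n/2}a₁⋯a_n / r)·φ(r)·q^{(n/2)·deg r}`. -/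
theorem exp_sum_even (p : ℕ) [Fact p.Prime] (hp : p ≠ 2)
    (Fq : Type) [Field Fq] [Fintype Fq] [Algebra (ZMod p) Fq]
    (n : ℕ) (hn : 0 < n) (hneven : Even n) (a : Fin n → Fq) (ha : ∀ i, a i ≠ 0)
    (r : Polynomial Fq) (hr : r.Monic) :
    (∑ᶠ c ∈ {c : Polynomial Fq |
        c.degree < ((r.natDegree : ℕ) : WithBot ℕ) ∧ IsCoprime c r},
      ∑ᶠ b ∈ {b : Fin n → Polynomial Fq |
          ∀ i, (b i).degree < ((r.natDegree : ℕ) : WithBot ℕ)},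
        polyPsi p r (c * ∑ i, Polynomial.C (a i) * b i ^ 2)) =
      (polyJacobi (Polynomial.C ((-1) ^ (n / 2) * ∏ i, a i)) r : ℂ) * (polyPhi r : ℂ) *
        (Fintype.card Fq : ℂ) ^ ((n / 2) * r.natDegree) := by
  have hfin : {c : Fq[X] | c.degree < ((r.natDegree : ℕ) : WithBot ℕ) ∧ IsCoprime c r}.Finite :=
    (finite_degree_lt r.natDegree).subset fun c hc => hc.1
  rw [finsum_mem_congr rfl fun c hc => finsum_polyPsi_diagonal p hp hneven a ha hr hc.2,
    ← ncard_reduced_residues_eq_polyPhi hr,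
    finsum_mem_eq_finite_toFinset_sum _ hfin, Finset.sum_const, nsmul_eq_mul,
    ← Set.ncard_eq_toFinset_card _ hfin]
  ring
end

section
/- Let n = 4 and suppose q is a power of an odd prime and (−1)²a₁a₂a₃a₄ = a₁a₂a₃a₄ is a square in 𝔽_q^×, where f = a₁X₁²+⋯+a₄X₄². Then for every P ≥ 1, the number N(P) of x ∈ 𝔽_q[t]^4 with deg(x_i) < P and f(x) = 0 equals ((q²−1)/q)·P·q^{2P} + q^{2P}. -/
open Polynomial

/-- `N(P)`: the number of `x ∈ 𝔽_q[t]^n` with all `deg x_i < P` and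
`a₁x₁² + ⋯ + a_nx_n² = 0`. -/
noncomputable def diagCount {Fq : Type} [Field Fq] {n : ℕ} (a : Fin n → Fq) (P : ℕ) : ℕ :=
  Nat.card {x : Fin n → Polynomial Fq //
    (∀ i, (x i).degree < (P : WithBot ℕ)) ∧ ∑ i, Polynomial.C (a i) * x i ^ 2 = 0}

section PolynomialPairs

variable {F : Type} [Field F]

/-- Pairs of polynomials of degree less than `P` proportional to `(a, b)`. -/
def proportionalPairs (a b : F[X]) (P : ℕ) : Set (F[X] × F[X]) :=
  {w | w.1.degree < (P : WithBot ℕ) ∧ w.2.degree < (P : WithBot ℕ) ∧ a * w.2 = b * w.1}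

theorem card_proportionalPairs_comm (a b : F[X]) (P : ℕ) :
    Nat.card (proportionalPairs a b P) = Nat.card (proportionalPairs b a P) :=
  Nat.card_congr <| (Equiv.prodComm _ _).subtypeEquiv fun w => by
    simp only [proportionalPairs, Set.mem_ofPred_eq, Equiv.prodComm_apply, Prod.fst_swap,
      Prod.snd_swap]
    tauto

theorem degree_lt_of_mul_eq_mul {a b u v : F[X]} (ha : a ≠ 0) (hab : b.degree ≤ a.degree)
    {P : ℕ} (hu : u.degree < (P : WithBot ℕ)) (h : a * v = b * u) :
    v.degree < (P : WithBot ℕ) := by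
  have hd := congrArg degree h
  rw [degree_mul, degree_mul] at hd
  refine lt_of_le_of_lt ?_ hu
  by_contra! hlt
  have ha' : a.degree ≠ ⊥ := by simpa using ha
  have : b.degree + u.degree < a.degree + v.degree :=
    lt_of_le_of_lt (add_le_add_left hab _) (WithBot.add_lt_add_left ha' hlt)
  exact absurd hd this.ne'

theorem degree_lt_iff_of_degree_lt_succ {p : F[X]} {P : ℕ}
    (hp : p.degree < ((P + 1 : ℕ) : WithBot ℕ)) :
    p.degree < (P : WithBot ℕ) ↔ p.coeff P = 0 := by
  rw [degree_lt_iff_coeff_zero] at hp ⊢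
  refine ⟨fun h => h P le_rfl, fun h m hm => ?_⟩
  rcases hm.eq_or_lt with rfl | hm
  · exact h
  · exact hp m hm

theorem card_proportionalPairs_succ_of_degree_le {a b : F[X]} (ha : a ≠ 0)
    (hab : b.degree ≤ a.degree) {P : ℕ} (haP : a.degree < ((P + 1 : ℕ) : WithBot ℕ)) :
    Nat.card (proportionalPairs a b (P + 1)) =
      Nat.card F * Nat.card (proportionalPairs a b P) := by
  have hm : a.natDegree ≤ P := by
    have := (natDegree_lt_iff_degree_lt ha).2 haP
    omega
  set e : F[X] := X ^ (P - a.natDegree) with he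
  have hcoeff : (e * a).coeff P = a.leadingCoeff := by
    have := coeff_X_pow_mul a (P - a.natDegree) a.natDegree
    rwa [Nat.add_sub_cancel' hm] at this
  have hl : a.leadingCoeff ≠ 0 := leadingCoeff_ne_zero.2 ha
  have hea : (e * a).degree < ((P + 1 : ℕ) : WithBot ℕ) := by
    rw [he, degree_mul, degree_X_pow, degree_eq_natDegree ha, ← Nat.cast_add, Nat.cast_lt]
    omega
  have hmono : ((P : ℕ) : WithBot ℕ) < ((P + 1 : ℕ) : WithBot ℕ) := by
    exact_mod_cast Nat.lt_succ_self P
  let f : F × proportionalPairs a b P → proportionalPairs a b (P + 1) := fun x =>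
    ⟨(x.2.1.1 + C x.1 * (e * a), x.2.1.2 + C x.1 * (e * b)), by
      obtain ⟨c, ⟨u, v⟩, hu, hv, huv⟩ := x
      have h1 : (u + C c * (e * a)).degree < ((P + 1 : ℕ) : WithBot ℕ) :=
        (degree_add_le _ _).trans_lt (max_lt (hu.trans hmono)
          (lt_of_le_of_lt (by rw [← smul_eq_C_mul]; exact degree_smul_le _ _) hea))
      have h2 : a * (v + C c * (e * b)) = b * (u + C c * (e * a)) := by
        simp only at huv
        linear_combination huv
      exact ⟨h1, degree_lt_of_mul_eq_mul ha hab h1 h2, h2⟩⟩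
  have hf : Function.Bijective f := by
    constructor
    · rintro ⟨c, ⟨u, v⟩, hu, hv, huv⟩ ⟨c', ⟨u', v'⟩, hu', hv', huv'⟩ h
      simp only [f, Subtype.mk.injEq, Prod.mk.injEq] at h
      simp only at hu hv hu' hv'
      have h0 : u.coeff P = 0 := (degree_lt_iff_of_degree_lt_succ (hu.trans hmono)).1 hu
      have h0' : u'.coeff P = 0 := (degree_lt_iff_of_degree_lt_succ (hu'.trans hmono)).1 hu'
      have hc := congrArg (fun p => coeff p P) h.1
      simp only [coeff_add, coeff_C_mul, hcoeff, h0, h0', zero_add] at hc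
      obtain rfl := mul_right_cancel₀ hl hc
      simp only [add_left_inj] at h
      obtain ⟨rfl, rfl⟩ := h
      rfl
    · rintro ⟨⟨u, v⟩, hu, hv, huv⟩
      simp only at hu hv huv
      set c := u.coeff P / a.leadingCoeff with hc
      have h1' : (u - C c * (e * a)).degree < ((P + 1 : ℕ) : WithBot ℕ) :=
        (degree_sub_le _ _).trans_lt (max_lt hu
          (lt_of_le_of_lt (by rw [← smul_eq_C_mul]; exact degree_smul_le _ _) hea))
      have h1 : (u - C c * (e * a)).degree < (P : WithBot ℕ) := by
        rw [degree_lt_iff_of_degree_lt_succ h1', coeff_sub, coeff_C_mul, hcoeff, hc,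
          div_mul_cancel₀ _ hl, sub_self]
      have h2 : a * (v - C c * (e * b)) = b * (u - C c * (e * a)) := by
        linear_combination huv
      refine ⟨⟨c, ⟨(u - C c * (e * a), v - C c * (e * b)), h1,
        degree_lt_of_mul_eq_mul ha hab h1 h2, h2⟩⟩, ?_⟩
      simp [f]
  rw [← Nat.card_congr (Equiv.ofBijective f hf), Nat.card_prod]

theorem card_proportionalPairs_succ {a b : F[X]} (h : (a, b) ≠ 0) {P : ℕ}
    (haP : a.degree < ((P + 1 : ℕ) : WithBot ℕ)) (hbP : b.degree < ((P + 1 : ℕ) : WithBot ℕ)) :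
    Nat.card (proportionalPairs a b (P + 1)) =
      Nat.card F * Nat.card (proportionalPairs a b P) := by
  rcases le_total b.degree a.degree with hab | hab
  · refine card_proportionalPairs_succ_of_degree_le ?_ hab haP
    rintro rfl
    simp_all
  · rw [card_proportionalPairs_comm a b, card_proportionalPairs_comm a b]
    refine card_proportionalPairs_succ_of_degree_le ?_ hab hbP
    rintro rfl
    simp_all

open scoped Classical in
/-- The point of the projective line over `F(t)` represented by a nonzero pair. -/
noncomputable def slope₂ (v : F[X] × F[X]) : Option (RatFunc F) :=
  if v.2 = 0 then none else some (algebraMap F[X] (RatFunc F) v.1 / algebraMap F[X] (RatFunc F) v.2)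

theorem slope₂_eq_iff {v w : F[X] × F[X]} (hv : v ≠ 0) (hw : w ≠ 0) :
    slope₂ v = slope₂ w ↔ v.1 * w.2 = v.2 * w.1 := by
  obtain ⟨a, b⟩ := v
  obtain ⟨c, d⟩ := w
  have hinj := IsFractionRing.injective F[X] (RatFunc F)
  by_cases hb : b = 0 <;> by_cases hd : d = 0
  · simp [slope₂, hb, hd]
  · simp_all [slope₂]
  · have : c ≠ 0 := by simp_all
    simp_all [slope₂]
  · have hb' : algebraMap F[X] (RatFunc F) b ≠ 0 := by simpa using hb
    have hd' : algebraMap F[X] (RatFunc F) d ≠ 0 := by simpa using hd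
    simp only [slope₂, hb, hd, if_false, Option.some.injEq]
    rw [div_eq_div_iff hb' hd', ← map_mul, ← map_mul, hinj.eq_iff, mul_comm c b]

variable [Fintype F]

theorem finite_setOf_degree_lt (P : ℕ) : {p : F[X] | p.degree < (P : WithBot ℕ)}.Finite := by
  have : Finite (degreeLT F P) := Finite.of_equiv _ (degreeLTEquiv F P).symm.toEquiv
  refine (Set.toFinite (degreeLT F P : Set F[X])).subset fun p hp => ?_
  simpa [mem_degreeLT] using hp

/-- The pairs of polynomials of degree less than `P`. -/
noncomputable def pairsLT (F : Type) [Field F] [Fintype F] (P : ℕ) : Finset (F[X] × F[X]) :=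
  (finite_setOf_degree_lt P).toFinset ×ˢ (finite_setOf_degree_lt P).toFinset

theorem mem_pairsLT {P : ℕ} {v : F[X] × F[X]} :
    v ∈ pairsLT F P ↔ v.1.degree < (P : WithBot ℕ) ∧ v.2.degree < (P : WithBot ℕ) := by
  simp [pairsLT]

theorem card_pairsLT (P : ℕ) : (pairsLT F P).card = Fintype.card F ^ (2 * P) := by
  have : (finite_setOf_degree_lt (F := F) P).toFinset.card = Fintype.card F ^ P := by
    rw [← Nat.card_eq_card_finite_toFinset]
    have e : {p : F[X] | p.degree < (P : WithBot ℕ)} ≃ (Fin P → F) :=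
      (Equiv.subtypeEquivRight fun p => by simp [mem_degreeLT]).trans
        (degreeLTEquiv F P).toEquiv
    rw [Nat.card_congr e]
    simp
  rw [pairsLT, Finset.card_product, this]
  ring

theorem zero_mem_pairsLT (P : ℕ) : (0 : F[X] × F[X]) ∈ pairsLT F P := by
  simp [mem_pairsLT]

open scoped Classical in
theorem card_filter_slope₂_add_one {v : F[X] × F[X]} (hv : v ≠ 0) (P : ℕ) :
    (((pairsLT F P).erase 0).filter fun w => slope₂ w = slope₂ v).card + 1 =
      Nat.card (proportionalPairs v.1 v.2 P) := by
  have h : (insert 0 (((pairsLT F P).erase 0).filter fun w => slope₂ w = slope₂ v) :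
      Finset _) = (pairsLT F P).filter fun w => v.1 * w.2 = v.2 * w.1 := by
    ext w
    by_cases hw : w = 0
    · subst hw
      simp [zero_mem_pairsLT]
    · simp [hw, eq_comm (a := slope₂ w), slope₂_eq_iff hv hw]
  rw [← Finset.card_insert_of_notMem (a := 0) (by simp), h, ← Nat.card_eq_finsetCard]
  exact Nat.card_congr (Equiv.subtypeEquivRight fun w => by
    simp [mem_pairsLT, proportionalPairs, and_assoc])

/-- The number of singular `2 × 2` matrices of polynomials of degree less than `P`. -/
noncomputable def singularCount (F : Type) [Field F] [Fintype F] (P : ℕ) : ℕ :=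
  ∑ v ∈ pairsLT F P, Nat.card (proportionalPairs v.1 v.2 P)

theorem card_proportionalPairs_zero (P : ℕ) :
    Nat.card (proportionalPairs (0 : F[X]) 0 P) = Fintype.card F ^ (2 * P) := by
  rw [← card_pairsLT, ← Nat.card_eq_finsetCard]
  exact Nat.card_congr (Equiv.subtypeEquivRight fun w => by
    simp [mem_pairsLT, proportionalPairs])

open scoped Classical in
theorem singularCount_eq (P : ℕ) (T : Finset (Option (RatFunc F)))
    (hT : ∀ v ∈ (pairsLT F P).erase 0, slope₂ v ∈ T) :
    (singularCount F P : ℤ) = 2 * (Fintype.card F : ℤ) ^ (2 * P) - 1 +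
      ∑ l ∈ T, ((((pairsLT F P).erase 0).filter fun w => slope₂ w = l).card : ℤ) ^ 2 := by
  have h1 : ∑ v ∈ (pairsLT F P).erase 0, Nat.card (proportionalPairs v.1 v.2 P) =
      ∑ v ∈ (pairsLT F P).erase 0,
        ((((pairsLT F P).erase 0).filter fun w => slope₂ w = slope₂ v).card + 1) :=
    Finset.sum_congr rfl fun v hv =>
      (card_filter_slope₂_add_one (Finset.ne_of_mem_erase hv) P).symm
  have h2 : ∑ v ∈ (pairsLT F P).erase 0,
        (((pairsLT F P).erase 0).filter fun w => slope₂ w = slope₂ v).card =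
      ∑ l ∈ T, (((pairsLT F P).erase 0).filter fun w => slope₂ w = l).card ^ 2 := by
    rw [← Finset.sum_fiberwise_of_maps_to hT]
    refine Finset.sum_congr rfl fun l _ => ?_
    rw [Finset.sum_congr rfl (g := fun _ =>
      (((pairsLT F P).erase 0).filter fun w => slope₂ w = l).card), Finset.sum_const, smul_eq_mul,
      sq]
    intro v hv
    rw [(Finset.mem_filter.1 hv).2]
  have h3 := Finset.card_erase_add_one (zero_mem_pairsLT (F := F) P)
  rw [card_pairsLT] at h3
  rw [singularCount, ← Finset.add_sum_erase _ _ (zero_mem_pairsLT P), h1,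
    Finset.sum_add_distrib, h2, Prod.fst_zero, Prod.snd_zero, card_proportionalPairs_zero]
  simp only [Finset.sum_const, smul_eq_mul, mul_one]
  zify at h3
  push_cast
  linear_combination h3

theorem singularCount_succ (P : ℕ) :
    (singularCount F (P + 1) : ℤ) = (Fintype.card F : ℤ) ^ 2 * singularCount F P +
      ((Fintype.card F : ℤ) ^ 2 - 1) * (Fintype.card F : ℤ) ^ (2 * P + 1) := by
  classical
  set T := ((pairsLT F (P + 1)).erase 0).image slope₂ with hTdef
  have hT1 : ∀ v ∈ (pairsLT F (P + 1)).erase 0, slope₂ v ∈ T :=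
    fun v hv => Finset.mem_image_of_mem _ hv
  have hT0 : ∀ v ∈ (pairsLT F P).erase 0, slope₂ v ∈ T := fun v hv => by
    have hlt : ((P : ℕ) : WithBot ℕ) < ((P + 1 : ℕ) : WithBot ℕ) := by
      exact_mod_cast Nat.lt_succ_self P
    have hv' := mem_pairsLT.1 (Finset.mem_of_mem_erase hv)
    exact hT1 v (Finset.mem_erase.2 ⟨Finset.ne_of_mem_erase hv,
      mem_pairsLT.2 ⟨hv'.1.trans hlt, hv'.2.trans hlt⟩⟩)
  let G : ℕ → Option (RatFunc F) → ℤ := fun R l =>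
    (((pairsLT F R).erase 0).filter fun w => slope₂ w = l).card
  have hG : ∀ l ∈ T, G (P + 1) l = Fintype.card F * G P l + (Fintype.card F - 1) := by
    intro l hl
    obtain ⟨v, hv, rfl⟩ := Finset.mem_image.1 hl
    have hv0 := Finset.ne_of_mem_erase hv
    have hv' := mem_pairsLT.1 (Finset.mem_of_mem_erase hv)
    have h := card_proportionalPairs_succ (a := v.1) (b := v.2) hv0 hv'.1 hv'.2
    rw [← card_filter_slope₂_add_one hv0, ← card_filter_slope₂_add_one hv0,
      Nat.card_eq_fintype_card] at h
    simp only [G]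
    zify at h
    linear_combination h
  have hsum : ∀ R, (∀ v ∈ (pairsLT F R).erase 0, slope₂ v ∈ T) →
      ∑ l ∈ T, G R l = (Fintype.card F : ℤ) ^ (2 * R) - 1 := by
    intro R hR
    have h3 := Finset.card_erase_add_one (zero_mem_pairsLT (F := F) R)
    rw [card_pairsLT, Finset.card_eq_sum_card_fiberwise hR] at h3
    zify at h3
    simp only [G]
    linear_combination h3
  have e0 := hsum P hT0
  have e1 := hsum (P + 1) hT1
  rw [Finset.sum_congr rfl hG, Finset.sum_add_distrib, ← Finset.mul_sum, e0, Finset.sum_const,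
    nsmul_eq_mul] at e1
  have c0 := singularCount_eq P T hT0
  have c1 := singularCount_eq (P + 1) T hT1
  have hsq : ∑ l ∈ T, G (P + 1) l ^ 2 = (Fintype.card F : ℤ) ^ 2 * ∑ l ∈ T, G P l ^ 2 +
      2 * Fintype.card F * (Fintype.card F - 1) * ∑ l ∈ T, G P l +
      T.card * ((Fintype.card F : ℤ) - 1) ^ 2 := by
    rw [Finset.mul_sum, Finset.mul_sum, ← nsmul_eq_mul, ← Finset.sum_const,
      ← Finset.sum_add_distrib, ← Finset.sum_add_distrib]
    refine Finset.sum_congr rfl fun l hl => ?_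
    rw [hG l hl]
    ring
  rw [e0] at hsq
  change _ = _ + ∑ l ∈ T, G P l ^ 2 at c0
  change _ = _ + ∑ l ∈ T, G (P + 1) l ^ 2 at c1
  linear_combination c1 + hsq - (Fintype.card F : ℤ) ^ 2 * c0 +
    ((Fintype.card F : ℤ) - 1) * e1

theorem singularCount_zero : singularCount F 0 = 1 := by
  have h : pairsLT F 0 = {0} := by
    ext ⟨a, b⟩
    have hd (p : F[X]) : p.degree < ((0 : ℕ) : WithBot ℕ) ↔ p = 0 := by
      rw [degree_lt_iff_coeff_zero]
      simp [Polynomial.ext_iff]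
    simp only [mem_pairsLT, hd, Finset.mem_singleton, Prod.mk_eq_zero]
  rw [singularCount, h, Finset.sum_singleton, Prod.fst_zero, Prod.snd_zero,
    card_proportionalPairs_zero]
  simp

theorem singularCount_formula (P : ℕ) :
    (singularCount F P : ℚ) =
      ((Fintype.card F : ℚ) ^ 2 - 1) / Fintype.card F * P * (Fintype.card F : ℚ) ^ (2 * P) +
        (Fintype.card F : ℚ) ^ (2 * P) := by
  have hq : (Fintype.card F : ℚ) ≠ 0 := by exact_mod_cast Fintype.card_ne_zero
  induction P with
  | zero => simp [singularCount_zero]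
  | succ P ih =>
    have h : ((singularCount F (P + 1) : ℤ) : ℚ) = _ := congrArg Int.cast (singularCount_succ P)
    push_cast at h
    rw [h, ih]
    push_cast
    field_simp
    ring

theorem singularCount_eq_card (P : ℕ) : singularCount F P =
    Nat.card {x : Fin 4 → F[X] // (∀ i, (x i).degree < (P : WithBot ℕ)) ∧
      x 0 * x 3 = x 1 * x 2} := by
  classical
  have hfin (v : F[X] × F[X]) : Finite (proportionalPairs v.1 v.2 P) :=
    ((pairsLT F P).finite_toSet.subset fun w hw => by
      simpa [mem_pairsLT] using And.intro hw.1 hw.2.1).to_subtype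
  rw [singularCount, ← Finset.sum_coe_sort, ← Nat.card_sigma]
  refine Nat.card_congr
    { toFun := fun s => ⟨![s.1.1.1, s.1.1.2, s.2.1.1, s.2.1.2], ?_, ?_⟩
      invFun := fun x => ⟨⟨(x.1 0, x.1 1), mem_pairsLT.2 ⟨x.2.1 0, x.2.1 1⟩⟩,
        ⟨(x.1 2, x.1 3), x.2.1 2, x.2.1 3, x.2.2⟩⟩
      left_inv := fun s => rfl
      right_inv := fun x => ?_ }
  · have h1 := mem_pairsLT.1 s.1.2
    have h2 := s.2.2
    intro i
    fin_cases i
    · exact h1.1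
    · exact h1.2
    · exact h2.1
    · exact h2.2.1
  · exact s.2.2.2.2
  · ext i : 2
    fin_cases i <;> rfl

/-- A diagonal quaternary form over a finite field of odd characteristic with square
discriminant is equivalent to the determinant. -/
theorem diagCount_eq_singularCount (hchar : ringChar F ≠ 2) (a : Fin 4 → F)
    (ha : ∀ i, a i ≠ 0) (hsq : IsSquare (∏ i, a i)) (P : ℕ) :
    diagCount a P = singularCount F P := by
  have h2 : (2 : F) ≠ 0 := Ring.two_ne_zero hchar
  obtain ⟨s, hs⟩ := hsq
  rw [Fin.prod_univ_four] at hs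
  obtain ⟨p, r, hpr⟩ : ∃ p r : F, a 0 * p ^ 2 + a 1 * r ^ 2 = -a 2 := by
    obtain ⟨p, r, h⟩ := FiniteField.exists_root_sum_quadratic
      (f := C (a 0) * X ^ 2 + C 0 * X + C 0) (g := C (a 1) * X ^ 2 + C 0 * X + C (a 2))
      (degree_quadratic (ha 0)) (degree_quadratic (ha 1))
      (FiniteField.odd_card_of_char_ne_two hchar)
    refine ⟨p, r, ?_⟩
    simp at h
    linear_combination h
  obtain ⟨h0, h1, h2', h3⟩ := And.intro (ha 0) (And.intro (ha 1) (And.intro (ha 2) (ha 3)))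
  have hs0 : s ≠ 0 := by
    rintro rfl
    simp_all
  set d := a 0 * a 1 with hd
  have hd0 : d ≠ 0 := mul_ne_zero h0 h1
  set k := s / (d * a 2) with hk
  have hk0 : k ≠ 0 := div_ne_zero hs0 (mul_ne_zero hd0 h2')
  have hk4 : a 3 = d * a 2 * k ^ 2 := by
    rw [hk]
    field_simp
    linear_combination hs
  -- constants inverse to those appearing in the change of variables
  obtain ⟨c, hc⟩ : ∃ c, c * a 2 = 1 := ⟨_, inv_mul_cancel₀ h2'⟩
  obtain ⟨m, hm⟩ : ∃ m, m * 2 = (1 : F) := ⟨_, inv_mul_cancel₀ h2⟩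
  obtain ⟨k', hk'⟩ : ∃ k', k' * k = 1 := ⟨_, inv_mul_cancel₀ hk0⟩
  obtain ⟨d', hd'⟩ : ∃ d', d' * d = 1 := ⟨_, inv_mul_cancel₀ hd0⟩
  have Cpr := congrArg C hpr
  have Ck4 := congrArg C hk4
  have Cc := congrArg C hc
  have Cm := congrArg C hm
  have Ck' := congrArg C hk'
  have Cd' := congrArg C hd'
  have Cd := congrArg C hd
  simp only [map_mul, map_add, map_neg, map_pow, map_one, map_ofNat] at Cpr Ck4 Cc Cm Ck' Cd' Cd
  have hmem (x : F[X]) : x.degree < (P : WithBot ℕ) ↔ x ∈ degreeLT F P := mem_degreeLT.symm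
  have hC (e : F) (x : F[X]) (hx : x ∈ degreeLT F P) : C e * x ∈ degreeLT F P := by
    rw [← smul_eq_C_mul]
    exact Submodule.smul_mem _ _ hx
  rw [singularCount_eq_card, diagCount]
  simp only [hmem, Fin.sum_univ_four]
  let u (x : Fin 4 → F[X]) : F[X] := -C c * (C (a 0) * C p * x 0 + C (a 1) * C r * x 1)
  let v (x : Fin 4 → F[X]) : F[X] := -C c * (C p * x 1 - C r * x 0)
  let u' (y : Fin 4 → F[X]) : F[X] := C m * (y 3 - y 0)
  let v' (y : Fin 4 → F[X]) : F[X] := C m * (C d' * y 1 + y 2)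
  have hx0 (x) : C p * u x - C (a 1) * C r * v x = x 0 := by
    linear_combination -C c * x 0 * Cpr + x 0 * Cc
  have hx1 (x) : C r * u x + C (a 0) * C p * v x = x 1 := by
    linear_combination -C c * x 1 * Cpr + x 1 * Cc
  let f (x : Fin 4 → F[X]) : Fin 4 → F[X] :=
    ![x 2 - u x, C d * (v x - C k * x 3), v x + C k * x 3, x 2 + u x]
  let g (y : Fin 4 → F[X]) : Fin 4 → F[X] :=
    ![C p * u' y - C (a 1) * C r * v' y, C r * u' y + C (a 0) * C p * v' y, C m * (y 0 + y 3),
      C m * C k' * (y 2 - C d' * y 1)]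
  have hu' (x) : u' (f x) = u x := by
    simp only [u', f, Matrix.cons_val]
    linear_combination u x * Cm
  have hv' (x) : v' (f x) = v x := by
    simp only [v', f, Matrix.cons_val]
    linear_combination C m * (v x - C k * x 3) * Cd' + v x * Cm
  have hu (y) : u (g y) = u' y := by
    simp only [u, g, Matrix.cons_val]
    linear_combination -C c * u' y * Cpr + u' y * Cc
  have hv (y) : v (g y) = v' y := by
    simp only [v, g, Matrix.cons_val]
    linear_combination -C c * v' y * Cpr + v' y * Cc
  have hgf (x) : g (f x) = x := by
    have e0 : g (f x) 0 = x 0 := by simp only [g, Matrix.cons_val, hu', hv', hx0]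
    have e1 : g (f x) 1 = x 1 := by simp only [g, Matrix.cons_val, hu', hv', hx1]
    have e2 : g (f x) 2 = x 2 := by
      simp only [g, f, Matrix.cons_val]
      linear_combination x 2 * Cm
    have e3 : g (f x) 3 = x 3 := by
      simp only [g, f, Matrix.cons_val]
      linear_combination -C m * C k' * (v x - C k * x 3) * Cd' + C k' * C k * x 3 * Cm + x 3 * Ck'
    ext1 i
    fin_cases i <;> assumption
  have hfg (y) : f (g y) = y := by
    have e0 : f (g y) 0 = y 0 := by
      simp only [f, Matrix.cons_val, hu]
      simp only [g, u', Matrix.cons_val]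
      linear_combination y 0 * Cm
    have e1 : f (g y) 1 = y 1 := by
      simp only [f, Matrix.cons_val, hv]
      simp only [g, v', Matrix.cons_val]
      linear_combination -C d * C m * (y 2 - C d' * y 1) * Ck' + C d * C d' * y 1 * Cm + y 1 * Cd'
    have e2 : f (g y) 2 = y 2 := by
      simp only [f, Matrix.cons_val, hv]
      simp only [g, v', Matrix.cons_val]
      linear_combination C m * (y 2 - C d' * y 1) * Ck' + y 2 * Cm
    have e3 : f (g y) 3 = y 3 := by
      simp only [f, Matrix.cons_val, hu]
      simp only [g, u', Matrix.cons_val]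
      linear_combination y 3 * Cm
    ext1 i
    fin_cases i <;> assumption
  have hf_mem (x) (hx : ∀ i, x i ∈ degreeLT F P) (i) : f x i ∈ degreeLT F P := by
    have hux : u x ∈ degreeLT F P := by
      simp only [u, ← C_neg, mul_assoc]
      exact hC _ _ (add_mem (hC _ _ (hC _ _ (hx 0))) (hC _ _ (hC _ _ (hx 1))))
    have hvx : v x ∈ degreeLT F P := by
      simp only [v, ← C_neg]
      exact hC _ _ (sub_mem (hC _ _ (hx 1)) (hC _ _ (hx 0)))
    have hk3 := hC k _ (hx 3)
    fin_cases i
    · exact sub_mem (hx 2) hux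
    · exact hC _ _ (sub_mem hvx hk3)
    · exact add_mem hvx hk3
    · exact add_mem (hx 2) hux
  have hg_mem (y) (hy : ∀ i, y i ∈ degreeLT F P) (i) : g y i ∈ degreeLT F P := by
    have huy : u' y ∈ degreeLT F P := hC _ _ (sub_mem (hy 3) (hy 0))
    have hvy : v' y ∈ degreeLT F P := hC _ _ (add_mem (hC _ _ (hy 1)) (hy 2))
    simp only [g, mul_assoc]
    fin_cases i
    · exact sub_mem (hC _ _ huy) (hC _ _ (hC _ _ hvy))
    · exact add_mem (hC _ _ huy) (hC _ _ (hC _ _ hvy))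
    · exact hC _ _ (add_mem (hy 0) (hy 3))
    · exact hC _ _ (hC _ _ (sub_mem (hy 2) (hC _ _ (hy 1))))
  have hform (x : Fin 4 → F[X]) : C (a 0) * x 0 ^ 2 + C (a 1) * x 1 ^ 2 + C (a 2) * x 2 ^ 2 +
      C (a 3) * x 3 ^ 2 = C (a 2) * (f x 0 * f x 3 - f x 1 * f x 2) := by
    rw [← hx0 x, ← hx1 x]
    simp only [f, Matrix.cons_val]
    rw [Ck4, Cd]
    linear_combination (u x ^ 2 + C (a 0) * C (a 1) * v x ^ 2) * Cpr
  refine Nat.card_congr (Equiv.subtypeEquiv ⟨f, g, hgf, hfg⟩ fun x => ?_)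
  have hmem_iff : (∀ i, x i ∈ degreeLT F P) ↔ ∀ i, f x i ∈ degreeLT F P :=
    ⟨hf_mem x, fun h => hgf x ▸ hg_mem _ h⟩
  rw [hform, mul_eq_zero, C_eq_zero, or_iff_right h2', sub_eq_zero, hmem_iff, Equiv.coe_fn_mk]

end PolynomialPairs

/-- For `n = 4`, `q` a power of an odd prime, and `a₁a₂a₃a₄` a square in `𝔽_q^×`
(note `(-1)² = 1`), for every `P ≥ 1`:
`N(P) = ((q²-1)/q)·P·q^{2P} + q^{2P}`. -/
theorem count_four_square (Fq : Type) [Field Fq] [Fintype Fq] (hchar : ringChar Fq ≠ 2)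
    (a : Fin 4 → Fq) (ha : ∀ i, a i ≠ 0) (hsq : IsSquare (∏ i, a i))
    (P : ℕ) (hP : 1 ≤ P) :
    (diagCount a P : ℚ) =
      ((Fintype.card Fq : ℚ) ^ 2 - 1) / (Fintype.card Fq : ℚ) * P *
          (Fintype.card Fq : ℚ) ^ (2 * P) +
        (Fintype.card Fq : ℚ) ^ (2 * P) := by
  rw [diagCount_eq_singularCount hchar a ha hsq, singularCount_formula]
end

section
/- Let n ≥ 6 be even, q a power of an odd prime, f = a₁X₁²+⋯+a_nX_n² with a_i ∈ 𝔽_q^× and (−1)^{n/2}a₁⋯a_n a square in 𝔽_q^×. Then for every P ≥ 1, N(P) = (q^{n/2} − 1)/(q^{n/2−1} − q) · q^{P(n−2)} − (q−1)(q^{n/2−1}+1)/(q^{n/2−1}−q) · q^{(n/2)P}. -/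
open Polynomial

section BilinearDuality

variable {F U V : Type*} [Field F] [AddCommGroup U] [Module F U] [AddCommGroup V] [Module F V]

theorem finrank_add_finrank_ker_flip [Module.Finite F U] [Module.Finite F V]
    (B : U →ₗ[F] V →ₗ[F] F) :
    Module.finrank F U + Module.finrank F (LinearMap.ker B.flip) =
      Module.finrank F V + Module.finrank F (LinearMap.ker B) := by
  have h₁ := LinearMap.finrank_range_add_finrank_ker B
  have h₂ : Module.finrank F (LinearMap.range B) + Module.finrank F (LinearMap.ker B.flip) =
      Module.finrank F V := by
    rw [← LinearMap.dualCoannihilator_range_eq_ker_flip]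
    exact Subspace.finrank_add_finrank_dualCoannihilator_eq (LinearMap.range B)
  omega

theorem card_mul_card_right_kernel [Finite F] [Module.Finite F U] [Module.Finite F V]
    (B : U →ₗ[F] V →ₗ[F] F) :
    Nat.card U * Nat.card {v // ∀ u, B u v = 0} =
      Nat.card V * Nat.card {u // ∀ v, B u v = 0} := by
  have hl : Nat.card {u // ∀ v, B u v = 0} = Nat.card (LinearMap.ker B) :=
    Nat.card_congr (Equiv.subtypeEquivRight fun u => by simp [LinearMap.ext_iff])
  have hr : Nat.card {v // ∀ u, B u v = 0} = Nat.card (LinearMap.ker B.flip) :=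
    Nat.card_congr (Equiv.subtypeEquivRight fun u => by simp [LinearMap.ext_iff])
  rw [hl, hr]
  rw [Module.natCard_eq_pow_finrank (K := F) (V := U),
    Module.natCard_eq_pow_finrank (K := F) (V := V),
    Module.natCard_eq_pow_finrank (K := F) (V := LinearMap.ker B),
    Module.natCard_eq_pow_finrank (K := F) (V := LinearMap.ker B.flip),
    ← pow_add, ← pow_add, finrank_add_finrank_ker_flip B]

end BilinearDuality

theorem sum_natCard_comm {α β : Type*} [Fintype α] [Fintype β] (r : α → β → Prop) :
    ∑ a, Nat.card {b // r a b} = ∑ b, Nat.card {a // r a b} := by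
  classical
  simp only [Nat.card_eq_fintype_card, Fintype.card_subtype]
  exact Finset.sum_card_bipartiteAbove_eq_sum_card_bipartiteBelow r

section HankelKernel

variable {F : Type*} [Field F]

instance finite_degreeLT (n : ℕ) : Module.Finite F (degreeLT F n) :=
  Module.Finite.equiv (degreeLTEquiv F n).symm

theorem finrank_degreeLT (n : ℕ) : Module.finrank F (degreeLT F n) = n := by
  rw [(degreeLTEquiv F n).finrank_eq, Module.finrank_fin_fun]

theorem mul_mem_degreeLT {a b n : ℕ} (h : a + b ≤ n + 1) {f g : F[X]}
    (hf : f ∈ degreeLT F a) (hg : g ∈ degreeLT F b) : f * g ∈ degreeLT F n := by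
  rw [mem_degreeLT] at *
  rcases eq_or_ne f 0 with rfl | hf0
  · simp
  rcases eq_or_ne g 0 with rfl | hg0
  · simp
  rw [degree_eq_natDegree (mul_ne_zero hf0 hg0), natDegree_mul hf0 hg0]
  rw [degree_eq_natDegree hf0] at hf
  rw [degree_eq_natDegree hg0] at hg
  norm_cast at *
  omega

/-- The kernel of the `a × b` Hankel form `(g, h) ↦ φ (g * h)`. -/
def hankelKer (φ : F[X] →ₗ[F] F) (a b : ℕ) : Submodule F F[X] where
  carrier := {g | g ∈ degreeLT F a ∧ ∀ h ∈ degreeLT F b, φ (g * h) = 0}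
  zero_mem' := by simp
  add_mem' := fun ⟨h₁, h₂⟩ ⟨h₃, h₄⟩ =>
    ⟨Submodule.add_mem _ h₁ h₃, fun h hh => by simp [add_mul, h₂ h hh, h₄ h hh]⟩
  smul_mem' := fun c _ ⟨h₁, h₂⟩ =>
    ⟨Submodule.smul_mem _ c h₁, fun h hh => by simp [h₂ h hh]⟩

theorem mem_hankelKer {φ : F[X] →ₗ[F] F} {a b : ℕ} {g : F[X]} :
    g ∈ hankelKer φ a b ↔ g ∈ degreeLT F a ∧ ∀ h ∈ degreeLT F b, φ (g * h) = 0 := Iff.rfl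

theorem hankelKer_le_degreeLT (φ : F[X] →ₗ[F] F) (a b : ℕ) :
    hankelKer φ a b ≤ degreeLT F a := fun _ h => h.1

instance finite_hankelKer (φ : F[X] →ₗ[F] F) (a b : ℕ) : Module.Finite F (hankelKer φ a b) :=
  Submodule.finiteDimensional_of_le (hankelKer_le_degreeLT φ a b)

/-- The bilinear form `(g, h) ↦ φ (g * h)` on polynomials of degrees below `a` and `b`. -/
noncomputable def hankelForm (φ : F[X] →ₗ[F] F) (a b : ℕ) :
    degreeLT F a →ₗ[F] degreeLT F b →ₗ[F] F :=
  ((LinearMap.mul F F[X]).compr₂ φ).domRestrict₁₂ (degreeLT F a) (degreeLT F b)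

@[simp]
theorem hankelForm_apply (φ : F[X] →ₗ[F] F) (a b : ℕ) (g : degreeLT F a) (h : degreeLT F b) :
    hankelForm φ a b g h = φ (g * h) := rfl

theorem finrank_ker_hankelForm (φ : F[X] →ₗ[F] F) (a b : ℕ) :
    Module.finrank F (LinearMap.ker (hankelForm φ a b)) = Module.finrank F (hankelKer φ a b) := by
  have h : (LinearMap.ker (hankelForm φ a b)).map (degreeLT F a).subtype = hankelKer φ a b := by
    ext g
    simp only [Submodule.mem_map, LinearMap.mem_ker, LinearMap.ext_iff, hankelForm_apply,
      mem_hankelKer, Submodule.subtype_apply, Subtype.exists, Subtype.forall, LinearMap.zero_apply,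
      exists_and_right, exists_eq_right]
    simp
  rw [← h, Submodule.finrank_map_subtype_eq]

theorem finrank_hankelKer_symm (φ : F[X] →ₗ[F] F) (a b : ℕ) :
    a + Module.finrank F (hankelKer φ b a) = b + Module.finrank F (hankelKer φ a b) := by
  have h := finrank_add_finrank_ker_flip (hankelForm φ a b)
  have hflip : (hankelForm φ a b).flip = hankelForm φ b a := by
    ext g h
    simp [mul_comm]
  rwa [hflip, finrank_ker_hankelForm, finrank_ker_hankelForm, finrank_degreeLT,
    finrank_degreeLT] at h

theorem hankelKer_mono (φ : F[X] →ₗ[F] F) {a a' b b' : ℕ} (ha : a ≤ a') (hb : b' ≤ b) :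
    hankelKer φ a b ≤ hankelKer φ a' b' :=
  fun _ h => ⟨degreeLT_mono ha h.1, fun k hk => h.2 k (degreeLT_mono hb hk)⟩

theorem X_mem_degreeLT_two : (X : F[X]) ∈ degreeLT F 2 := by
  rw [mem_degreeLT, degree_X]
  norm_num

theorem X_mul_mem_hankelKer (φ : F[X] →ₗ[F] F) {a b : ℕ} {g : F[X]}
    (hg : g ∈ hankelKer φ a (b + 1)) : X * g ∈ hankelKer φ (a + 1) b := by
  refine ⟨mul_mem_degreeLT (by omega) X_mem_degreeLT_two hg.1, fun h hh => ?_⟩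
  rw [mul_comm X g, mul_assoc]
  exact hg.2 _ (mul_mem_degreeLT (by omega) X_mem_degreeLT_two hh)

theorem finrank_hankelKer_lt (φ : F[X] →ₗ[F] F) {a b : ℕ}
    (h0 : 0 < Module.finrank F (hankelKer φ a (b + 1))) :
    Module.finrank F (hankelKer φ a (b + 1)) < Module.finrank F (hankelKer φ (a + 1) b) := by
  apply Submodule.finrank_lt_finrank_of_lt
  refine lt_of_le_of_ne (hankelKer_mono φ (by omega) (by omega)) fun heq => ?_
  obtain ⟨⟨g, hg⟩, hg0⟩ := Module.finrank_pos_iff_exists_ne_zero.mp h0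
  have hg0 : g ≠ 0 := fun h => hg0 (Subtype.ext h)
  have hpow : ∀ k : ℕ, X ^ k * g ∈ hankelKer φ a (b + 1) := fun k => by
    induction k with
    | zero => simpa using hg
    | succ k ih =>
      rw [pow_succ', mul_assoc, heq]
      exact X_mul_mem_hankelKer φ ih
  have hdeg := mem_degreeLT.mp (hpow a).1
  rw [degree_eq_natDegree (mul_ne_zero (pow_ne_zero _ X_ne_zero) hg0),
    natDegree_mul (pow_ne_zero _ X_ne_zero) hg0, natDegree_X_pow] at hdeg
  norm_cast at hdeg
  omega

theorem finrank_hankelKer_pred (φ : F[X] →ₗ[F] F) {a b : ℕ} (hab : a < b) :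
    Module.finrank F (hankelKer φ a (b + 1)) = Module.finrank F (hankelKer φ (a + 1) b) - 1 := by
  have h₁ := finrank_hankelKer_symm φ a (b + 1)
  have h₂ := finrank_hankelKer_symm φ (a + 1) b
  have h₃ : Module.finrank F (hankelKer φ (a + 1) b) ≤ Module.finrank F (hankelKer φ b (a + 1)) :=
    Submodule.finrank_mono (hankelKer_mono φ (by omega) (by omega))
  have h₄ := finrank_hankelKer_lt φ (a := a) (b := b)
  have h₅ := finrank_hankelKer_lt φ (a := b) (b := a)
  omega

/-- Close to the square shape, the kernel dimension drops by one per step until it vanishes. -/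
theorem finrank_hankelKer_sub (φ : F[X] →ₗ[F] F) {P k : ℕ} (hk : k ≤ P) :
    Module.finrank F (hankelKer φ (P - k) (P + k)) =
      Module.finrank F (hankelKer φ P P) - k := by
  induction k with
  | zero => simp
  | succ k ih =>
    have h := finrank_hankelKer_pred φ (a := P - (k + 1)) (b := P + k) (by omega)
    rw [show P - (k + 1) + 1 = P - k by omega, ih (by omega)] at h
    rw [← add_assoc, h]
    omega

theorem finrank_hankelKer_le (φ : F[X] →ₗ[F] F) (a b : ℕ) :
    Module.finrank F (hankelKer φ a b) ≤ a := by
  simpa [finrank_degreeLT] using Submodule.finrank_mono (hankelKer_le_degreeLT φ a b)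

end HankelKernel

section HankelCount

variable {F : Type*} [Field F]

/-- The functional `p ↦ ∑ sₖ pₖ` on polynomials attached to a vector `s`. -/
noncomputable def coeffFunctional (N : ℕ) : (Fin N → F) →ₗ[F] F[X] →ₗ[F] F :=
  LinearMap.mk₂ F (fun s p => ∑ k, s k * p.coeff k)
    (by simp [add_mul, Finset.sum_add_distrib])
    (by simp [mul_assoc, Finset.mul_sum])
    (by simp [mul_add, Finset.sum_add_distrib])
    (by simp [mul_left_comm, Finset.mul_sum])

theorem coeffFunctional_apply {N : ℕ} (s : Fin N → F) (p : F[X]) :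
    coeffFunctional N s p = ∑ k, s k * p.coeff k := rfl

theorem forall_coeffFunctional_eq_zero {N : ℕ} {p : F[X]} (hp : p ∈ degreeLT F N) :
    (∀ s : Fin N → F, coeffFunctional N s p = 0) ↔ p = 0 := by
  refine ⟨fun h => ?_, fun h => by simp [h]⟩
  ext k
  by_cases hk : k < N
  · have := h (Pi.single ⟨k, hk⟩ 1)
    simpa [coeffFunctional_apply, Pi.single_apply] using this
  · exact coeff_eq_zero_of_degree_lt ((mem_degreeLT.mp hp).trans_le (by exact_mod_cast not_lt.mp hk))

variable [Fintype F]

theorem card_degreeLT (n : ℕ) : Nat.card (degreeLT F n) = Fintype.card F ^ n := by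
  rw [Module.natCard_eq_pow_finrank (K := F), finrank_degreeLT, Nat.card_eq_fintype_card]

noncomputable instance fintype_degreeLT (n : ℕ) : Fintype (degreeLT F n) :=
  have := Module.finite_of_finite F (M := degreeLT F n)
  Fintype.ofFinite _

/-- The functionals on `degreeLT F N` vanishing on `g * degreeLT F b`, for `g ≠ 0`. -/
theorem card_functionals_annihilating {N a b : ℕ} (hab : a + b = N + 1) {g : F[X]}
    (hg : g ∈ degreeLT F a) (hg0 : g ≠ 0) :
    Fintype.card F ^ b *
      Nat.card {s : Fin N → F // ∀ h : degreeLT F b, coeffFunctional N s (g * h) = 0} =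
    Fintype.card F ^ N := by
  have h := card_mul_card_right_kernel (((coeffFunctional (F := F) N).compl₂
    ((LinearMap.mulLeft F g).comp (degreeLT F b).subtype)).flip)
  have h1 : Nat.card {u : degreeLT F b // ∀ s : Fin N → F,
      coeffFunctional N s (g * u) = 0} = 1 := by
    rw [Nat.card_eq_one_iff_unique]
    have key : ∀ u : degreeLT F b, (∀ s : Fin N → F, coeffFunctional N s (g * u) = 0) → u = 0 := by
      intro u hu
      have := (forall_coeffFunctional_eq_zero (mul_mem_degreeLT (by omega) hg u.2)).mp hu
      exact Subtype.ext ((mul_eq_zero.mp this).resolve_left hg0)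
    exact ⟨⟨fun u v => Subtype.ext ((key _ u.2).trans (key _ v.2).symm)⟩, ⟨0, by simp⟩⟩
  simp only [LinearMap.flip_apply, LinearMap.compl₂_apply, LinearMap.comp_apply,
    Submodule.subtype_apply, LinearMap.mulLeft_apply] at h
  rw [h1, card_degreeLT] at h
  simpa using h

theorem card_hankelKer (φ : F[X] →ₗ[F] F) (a b : ℕ) :
    Nat.card {g : degreeLT F a // ∀ h : degreeLT F b, φ (g * h) = 0} =
      Fintype.card F ^ Module.finrank F (hankelKer φ a b) := by
  rw [← Nat.card_eq_fintype_card, ← finrank_ker_hankelForm,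
    ← Module.natCard_eq_pow_finrank (K := F) (V := LinearMap.ker (hankelForm φ a b))]
  exact Nat.card_congr (Equiv.subtypeEquivRight fun u => by simp [LinearMap.ext_iff])

theorem sum_pow_finrank_hankelKer {N a b : ℕ} (hab : a + b = N + 1) (hb : b ≤ N) :
    ∑ s : Fin N → F, Fintype.card F ^ Module.finrank F (hankelKer (coeffFunctional N s) a b) =
      Fintype.card F ^ N + (Fintype.card F ^ a - 1) * Fintype.card F ^ (N - b) := by
  classical
  simp only [← card_hankelKer]
  rw [sum_natCard_comm, ← Finset.add_sum_erase _ _ (Finset.mem_univ 0)]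
  congr 1
  · simp
  · have hq : 0 < Fintype.card F := Fintype.card_pos
    have hcard : Fintype.card F ^ a - 1 = (Finset.univ.erase (0 : degreeLT F a)).card := by
      rw [Finset.card_erase_of_mem (Finset.mem_univ _), Finset.card_univ,
        ← Nat.card_eq_fintype_card (α := degreeLT F a), card_degreeLT]
    rw [hcard, ← smul_eq_mul, ← Finset.sum_const]
    refine Finset.sum_congr rfl fun g hg => ?_
    have h := card_functionals_annihilating hab g.2
      (fun h => Finset.ne_of_mem_erase hg (Subtype.ext h))
    refine Nat.eq_of_mul_eq_mul_left (pow_pos hq b) ?_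
    rw [h, ← pow_add]
    congr 1
    omega

theorem card_hyperbolic_mul (m P : ℕ) :
    Nat.card {z : (Fin m → degreeLT F P) × (Fin m → degreeLT F P) //
        ∑ i, (z.1 i : F[X]) * z.2 i = 0} * Fintype.card F ^ (2 * P - 1) =
      Fintype.card F ^ (m * P) * ∑ s : Fin (2 * P - 1) → F,
        (Fintype.card F ^ Module.finrank F
          (hankelKer (coeffFunctional (2 * P - 1) s) P P)) ^ m := by
  classical
  have hfib : Nat.card {z : (Fin m → degreeLT F P) × (Fin m → degreeLT F P) //
      ∑ i, (z.1 i : F[X]) * z.2 i = 0} =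
      ∑ y : Fin m → degreeLT F P, Nat.card {w : Fin m → degreeLT F P //
        ∑ i, (y i : F[X]) * w i = 0} := by
    rw [← Nat.card_sigma]
    exact Nat.card_congr (Equiv.subtypeProdEquivSigmaSubtype fun y w : Fin m → degreeLT F P =>
      ∑ i, (y i : F[X]) * w i = 0)
  have hdual (y : Fin m → degreeLT F P) : Nat.card {w : Fin m → degreeLT F P //
        ∑ i, (y i : F[X]) * w i = 0} * Fintype.card F ^ (2 * P - 1) =
      Fintype.card F ^ (m * P) * Nat.card {s : Fin (2 * P - 1) → F //
        ∀ w : Fin m → degreeLT F P,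
          coeffFunctional (2 * P - 1) s (∑ i, (y i : F[X]) * w i) = 0} := by
    let L : (Fin m → degreeLT F P) →ₗ[F] F[X] :=
      ∑ i, ((LinearMap.mulLeft F (y i : F[X])).comp (degreeLT F P).subtype).comp (LinearMap.proj i)
    have hL (w) : L w = ∑ i, (y i : F[X]) * w i := by simp [L]
    have h := card_mul_card_right_kernel ((coeffFunctional (F := F) (2 * P - 1)).compl₂ L).flip
    simp only [LinearMap.flip_apply, LinearMap.compl₂_apply, hL] at h
    have hz : Nat.card {w : Fin m → degreeLT F P // ∀ s : Fin (2 * P - 1) → F,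
        coeffFunctional (2 * P - 1) s (∑ i, (y i : F[X]) * w i) = 0} =
        Nat.card {w : Fin m → degreeLT F P // ∑ i, (y i : F[X]) * w i = 0} :=
      Nat.card_congr (Equiv.subtypeEquivRight fun w => forall_coeffFunctional_eq_zero
        (Submodule.sum_mem _ fun i _ => mul_mem_degreeLT (by omega) (y i).2 (w i).2))
    have hU : Nat.card (Fin m → degreeLT F P) = Fintype.card F ^ (m * P) := by
      rw [Nat.card_fun, card_degreeLT, ← pow_mul, mul_comm]
      simp
    rw [hz, hU] at h
    rw [h, mul_comm]
    simp
  have hker (s : Fin (2 * P - 1) → F) : Nat.card {y : Fin m → degreeLT F P //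
      ∀ w : Fin m → degreeLT F P,
        coeffFunctional (2 * P - 1) s (∑ i, (y i : F[X]) * w i) = 0} =
      (Fintype.card F ^ Module.finrank F
          (hankelKer (coeffFunctional (2 * P - 1) s) P P)) ^ m := by
    rw [← card_hankelKer]
    have : Nat.card (Fin m → {g : degreeLT F P // ∀ h : degreeLT F P,
        coeffFunctional (2 * P - 1) s (g * h) = 0}) = _ := Nat.card_fun
    rw [Nat.card_fin] at this
    rw [← this, ← Nat.card_congr Equiv.subtypePiEquivPi]
    refine Nat.card_congr (Equiv.subtypeEquivRight fun y => ⟨fun h i g => ?_, fun h w => ?_⟩)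
    · have := h (Pi.single i g)
      rwa [Finset.sum_eq_single i (fun j _ hj => by simp [hj]) (by simp), Pi.single_eq_same] at this
    · rw [map_sum]
      exact Finset.sum_eq_zero fun i _ => h i (w i)
  rw [hfib, Finset.sum_mul, Finset.sum_congr rfl fun y _ => hdual y, ← Finset.mul_sum,
    sum_natCard_comm, Finset.sum_congr rfl fun s _ => hker s]

end HankelCount

section DiagonalForms

variable {F A : Type*} [Field F] [CommRing A] [Algebra F A]

/-- The diagonal forms with coefficients `a` and `b` agree up to a bijection of the tuples with
entries in the subspace `V`. -/
def DiagEquiv (V : Submodule F A) {n : ℕ} (a b : Fin n → F) : Prop :=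
  ∃ e : (Fin n → V) ≃ (Fin n → V), ∀ x, ∑ i, b i • (e x i : A) ^ 2 = ∑ i, a i • (x i : A) ^ 2

namespace DiagEquiv

variable {V : Submodule F A} {n : ℕ}

theorem trans {a b c : Fin n → F} (hab : DiagEquiv V a b) (hbc : DiagEquiv V b c) :
    DiagEquiv V a c := by
  obtain ⟨e, he⟩ := hab
  obtain ⟨e', he'⟩ := hbc
  exact ⟨e.trans e', fun x => by simp [he', he]⟩

theorem cons {a b : Fin n → F} (c : F) (h : DiagEquiv V a b) :
    DiagEquiv V (Fin.cons c a : Fin (n + 1) → F) (Fin.cons c b : Fin (n + 1) → F) := by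
  obtain ⟨e, he⟩ := h
  refine ⟨(Fin.consEquiv fun _ => V).symm.trans
    (((Equiv.refl V).prodCongr e).trans (Fin.consEquiv fun _ => V)), fun x => ?_⟩
  simp [Fin.sum_univ_succ, Fin.consEquiv, he, Fin.tail]

theorem of_mul_eq_sq {a b : F} (ha : a ≠ 0) (hb : b ≠ 0) {s : F} (hs : a * b = s * s) :
    DiagEquiv V (fun _ : Fin 1 => a) (fun _ => b) := by
  have hs0 : s ≠ 0 := fun h => mul_ne_zero ha hb (by simp [hs, h])
  refine ⟨(LinearEquiv.smulOfNeZero F (Fin 1 → V) (s * b⁻¹)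
    (mul_ne_zero hs0 (inv_ne_zero hb))).toEquiv, fun x => ?_⟩
  simp only [Finset.univ_unique, Finset.sum_singleton, LinearEquiv.coe_toEquiv,
    LinearEquiv.smulOfNeZero_apply, Pi.smul_apply, Submodule.coe_smul, _root_.smul_pow, smul_smul]
  congr 1
  field_simp
  linear_combination -hs

/-- A binary diagonal form representing `c ≠ 0` can be given `c` as its first coefficient. -/
theorem cons_cons {a₀ a₁ c u v : F} (a : Fin n → F) (hc : c ≠ 0)
    (huv : a₀ * u ^ 2 + a₁ * v ^ 2 = c) :
    DiagEquiv V (Fin.cons a₀ (Fin.cons a₁ a : Fin (n + 1) → F) : Fin (n + 2) → F)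
      (Fin.cons c (Fin.cons (c⁻¹ * (a₀ * a₁)) a : Fin (n + 1) → F) : Fin (n + 2) → F) := by
  have hx : c⁻¹ * (a₀ * u ^ 2 + a₁ * v ^ 2) = 1 := by rw [huv, inv_mul_cancel₀ hc]
  have hx' := congrArg (algebraMap F A) hx
  have hc' := congrArg (algebraMap F A) (inv_mul_cancel₀ hc)
  simp only [map_mul, map_add, map_pow, map_one] at hx' hc'
  let f : V × V ≃ V × V :=
    { toFun := fun p => (c⁻¹ • ((a₀ * u) • p.1 + (a₁ * v) • p.2), u • p.2 - v • p.1)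
      invFun := fun p => (u • p.1 - (c⁻¹ * a₁ * v) • p.2, v • p.1 + (c⁻¹ * a₀ * u) • p.2)
      left_inv := by
        rintro ⟨⟨x, hx⟩, ⟨y, hy⟩⟩
        ext
        · simp [Algebra.smul_def]
          linear_combination x * hx'
        · simp [Algebra.smul_def]
          linear_combination y * hx'
      right_inv := by
        rintro ⟨⟨x, hx⟩, ⟨y, hy⟩⟩
        ext
        · simp [Algebra.smul_def]
          linear_combination x * hx'
        · simp [Algebra.smul_def]
          linear_combination y * hx' }
  have hf (p : V × V) : c • ((f p).1 : A) ^ 2 + (c⁻¹ * (a₀ * a₁)) • ((f p).2 : A) ^ 2 =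
      a₀ • (p.1 : A) ^ 2 + a₁ • (p.2 : A) ^ 2 := by
    obtain ⟨⟨x, hx⟩, ⟨y, hy⟩⟩ := p
    simp [f, Algebra.smul_def]
    set α := algebraMap F A a₀
    set β := algebraMap F A a₁
    set γ := algebraMap F A c
    set γ' := algebraMap F A c⁻¹
    set μ := algebraMap F A u
    set ν := algebraMap F A v
    linear_combination (α * x ^ 2 + β * y ^ 2) * hx' +
      γ' * (α * μ * x + β * ν * y) ^ 2 * hc'
  let e : (Fin (n + 2) → V) ≃ (V × V) × (Fin n → V) :=
    ((Fin.consEquiv fun _ => V).symm.trans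
      ((Equiv.refl V).prodCongr (Fin.consEquiv fun _ => V).symm)).trans (Equiv.prodAssoc _ _ _).symm
  refine ⟨e.trans ((f.prodCongr (Equiv.refl _)).trans e.symm), fun x => ?_⟩
  have := hf (x 0, x 1)
  simp [Fin.sum_univ_succ, Fin.consEquiv, e, Fin.tail, ← add_assoc]
  simpa using this

end DiagEquiv

variable [Fintype F]

theorem exists_binary_diag_eq (hF : ringChar F ≠ 2) {a b : F} (ha : a ≠ 0) (hb : b ≠ 0) (c : F) :
    ∃ u v, a * u ^ 2 + b * v ^ 2 = c := by
  obtain ⟨u, v, h⟩ := FiniteField.exists_root_sum_quadratic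
    (f := C a * X ^ 2 + C 0 * X + C (-c)) (g := C b * X ^ 2 + C 0 * X + C 0)
    (degree_quadratic ha) (degree_quadratic hb) (FiniteField.odd_card_of_char_ne_two hF)
  refine ⟨u, v, ?_⟩
  simp at h
  linear_combination h

/-- Over a finite field of odd characteristic, nondegenerate diagonal forms are classified by
their discriminant. -/
theorem diagEquiv_of_isSquare (hF : ringChar F ≠ 2) (V : Submodule F A) {n : ℕ} (a b : Fin n → F)
    (ha : ∀ i, a i ≠ 0) (hb : ∀ i, b i ≠ 0) (hsq : IsSquare ((∏ i, a i) * ∏ i, b i)) :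
    DiagEquiv V a b := by
  induction n with
  | zero => exact ⟨Equiv.refl _, by simp⟩
  | succ n ih =>
    cases n with
    | zero =>
      obtain ⟨s, hs⟩ := hsq
      have h : ∀ c : Fin 1 → F, c = fun _ => c 0 := fun c => funext fun i => by
        rw [Subsingleton.elim i 0]
      rw [h a, h b]
      exact DiagEquiv.of_mul_eq_sq (ha 0) (hb 0) (by simpa using hs)
    | succ n =>
      obtain ⟨a₀, a, rfl⟩ : ∃ a₀ a', a = Fin.cons a₀ a' := ⟨_, _, (Fin.cons_self_tail a).symm⟩
      obtain ⟨a₁, a, rfl⟩ : ∃ a₁ a', a = Fin.cons a₁ a' := ⟨_, _, (Fin.cons_self_tail a).symm⟩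
      obtain ⟨b₀, b, rfl⟩ : ∃ b₀ b', b = Fin.cons b₀ b' := ⟨_, _, (Fin.cons_self_tail b).symm⟩
      have hb₀ : b₀ ≠ 0 := by simpa using hb 0
      have ha₀ : a₀ ≠ 0 := by simpa using ha 0
      have ha₁ : a₁ ≠ 0 := by simpa using ha 1
      have ha' : ∀ i, a i ≠ 0 := fun i => by simpa using ha i.succ.succ
      obtain ⟨u, v, huv⟩ := exists_binary_diag_eq hF ha₀ ha₁ b₀
      refine (DiagEquiv.cons_cons a hb₀ huv).trans (DiagEquiv.cons b₀ (ih _ _ ?_ ?_ ?_))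
      · refine Fin.cases ?_ ?_
        · simp [ha₀, ha₁, hb₀]
        · simpa using ha'
      · exact fun i => by simpa using hb i.succ
      · obtain ⟨s, hs⟩ := hsq
        simp only [Fin.prod_univ_succ (n := n + 1), Fin.cons_zero, Fin.cons_succ] at hs
        simp only [Fin.prod_univ_succ (n := n), Fin.cons_zero, Fin.cons_succ] at hs ⊢
        refine ⟨s * b₀⁻¹, ?_⟩
        field_simp
        linear_combination hs

end DiagonalForms

section Hyperbolic

/-- The bijection `(y, z) ↦ (y - z, y + z)`, in characteristic other than two. -/
def subAddEquiv {F W : Type*} [Field F] [AddCommGroup W] [Module F W] (h2 : (2 : F) ≠ 0) :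
    W × W ≃ W × W where
  toFun p := (p.1 - p.2, p.1 + p.2)
  invFun p := ((2⁻¹ : F) • (p.1 + p.2), (2⁻¹ : F) • (p.2 - p.1))
  left_inv p := by
    ext1
    · dsimp only
      rw [inv_smul_eq_iff₀ h2, two_smul]
      abel
    · dsimp only
      rw [inv_smul_eq_iff₀ h2, two_smul]
      abel
  right_inv p := by
    ext1
    · dsimp only
      rw [← smul_sub, inv_smul_eq_iff₀ h2, two_smul]
      abel
    · dsimp only
      rw [← smul_add, inv_smul_eq_iff₀ h2, two_smul]
      abel

variable {F : Type} [Field F]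

theorem diagCount_eq_card (n : ℕ) (a : Fin n → F) (P : ℕ) :
    diagCount a P =
      Nat.card {x : Fin n → degreeLT F P // ∑ i, a i • (x i : F[X]) ^ 2 = 0} := by
  refine Nat.card_congr
    { toFun := fun x => ⟨fun i => ⟨x.1 i, mem_degreeLT.mpr (x.2.1 i)⟩, ?_⟩
      invFun := fun x => ⟨fun i => x.1 i, fun i => mem_degreeLT.mp (x.1 i).2, ?_⟩
      left_inv := fun _ => rfl
      right_inv := fun _ => rfl }
  · simpa [smul_eq_C_mul] using x.2.2
  · simpa [smul_eq_C_mul] using x.2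

theorem diagCount_eq_card_hyperbolic [Fintype F] (hF : ringChar F ≠ 2) {m : ℕ} (a : Fin (m + m) → F)
    (ha : ∀ i, a i ≠ 0) (hsq : IsSquare ((-1 : F) ^ m * ∏ i, a i)) (P : ℕ) :
    diagCount a P =
      Nat.card {z : (Fin m → degreeLT F P) × (Fin m → degreeLT F P) //
        ∑ i, (z.1 i : F[X]) * z.2 i = 0} := by
  have h2 : (2 : F) ≠ 0 := Ring.two_ne_zero hF
  let b : Fin (m + m) → F := Fin.append (fun _ => 1) (fun _ => -1)
  have hbl (i : Fin m) : b (Fin.castAdd m i) = 1 := Fin.append_left _ _ i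
  have hbr (i : Fin m) : b (Fin.natAdd m i) = -1 := Fin.append_right _ _ i
  have hb : ∀ i, b i ≠ 0 := fun i => by
    refine Fin.addCases (fun j => ?_) (fun j => ?_) i
    · rw [hbl]
      exact one_ne_zero
    · rw [hbr]
      exact neg_ne_zero.mpr one_ne_zero
  have hprod : ∏ i, b i = (-1) ^ m := by
    rw [Fin.prod_univ_add]
    simp only [hbl, hbr, Finset.prod_const, Finset.card_univ, Fintype.card_fin, one_pow, one_mul]
  obtain ⟨e, he⟩ := diagEquiv_of_isSquare hF (degreeLT F P) a b ha hb
    (by rwa [hprod, mul_comm])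
  let f := subAddEquiv (F := F) (W := Fin m → degreeLT F P) h2
  rw [diagCount_eq_card]
  refine Nat.card_congr (Equiv.subtypeEquiv ((e.trans (Fin.appendEquiv m m).symm).trans f)
    fun x => ?_)
  rw [← he x, Fin.sum_univ_add, ← Finset.sum_add_distrib]
  refine Eq.congr (Finset.sum_congr rfl fun i _ => ?_) rfl
  rw [hbl, hbr, one_smul, neg_one_smul]
  simp only [f, subAddEquiv, Fin.appendEquiv, Equiv.trans_apply, Equiv.coe_fn_mk, Equiv.coe_fn_symm_mk,
    Pi.sub_apply, Pi.add_apply, Submodule.coe_sub, Submodule.coe_add]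
  ring

end Hyperbolic

section ClosedForm

theorem sub_one_mul_pow_eq_sum (q Q : ℚ) {P D : ℕ} (hD : D ≤ P) :
    (q - 1) * Q ^ D = (q - 1) + ∑ j ∈ Finset.range P, (Q ^ (j + 1) - 1) *
      (q ^ (D - j) - (q + 1) * q ^ (D - (j + 1)) + q * q ^ (D - (j + 2))) := by
  have hbracket (j : ℕ) : q ^ (D - j) - (q + 1) * q ^ (D - (j + 1)) + q * q ^ (D - (j + 2)) =
      if D = j + 1 then q - 1 else 0 := by
    split_ifs with h
    · subst h
      simp
      ring
    · rcases Nat.lt_or_ge D (j + 1) with h' | h'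
      · rw [show D - j = 0 by omega, show D - (j + 1) = 0 by omega, show D - (j + 2) = 0 by omega]
        ring
      · obtain ⟨k, rfl⟩ : ∃ k, D = j + 2 + k := ⟨D - (j + 2), by omega⟩
        rw [show j + 2 + k - j = k + 2 by omega, show j + 2 + k - (j + 1) = k + 1 by omega,
          show j + 2 + k - (j + 2) = k by omega]
        ring
  simp only [hbracket]
  rcases D with _ | D
  · simp
  · simp only [Nat.add_right_cancel_iff, mul_ite, mul_zero, Finset.sum_ite_eq, Finset.mem_range]
    rw [if_pos (by omega)]
    ring

theorem geometric_closed_form (q Q : ℚ) (p : ℕ) :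
    (Q - q ^ 2) * (q ^ (2 * p + 1) + (Q ^ (p + 1) - 1) +
      (q ^ 2 - 1) * ∑ j ∈ Finset.range p, (Q ^ (j + 1) - 1) * q ^ (2 * (p - 1 - j))) =
    (Q - 1) * Q ^ (p + 1) - (q - 1) * (Q + q) * q ^ (2 * p + 1) := by
  induction p with
  | zero => simp; ring
  | succ p ih =>
    have hsum : ∑ j ∈ Finset.range p, (Q ^ (j + 1) - 1) * q ^ (2 * (p + 1 - 1 - j)) =
        q ^ 2 * ∑ j ∈ Finset.range p, (Q ^ (j + 1) - 1) * q ^ (2 * (p - 1 - j)) := by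
      rw [Finset.mul_sum]
      refine Finset.sum_congr rfl fun j hj => ?_
      rw [show 2 * (p + 1 - 1 - j) = 2 * (p - 1 - j) + 2 by
        have := Finset.mem_range.mp hj
        omega]
      ring
    rw [Finset.sum_range_succ, hsum]
    simp only [add_tsub_cancel_right, tsub_self, mul_zero, pow_zero, mul_one]
    linear_combination q ^ 2 * ih

variable {F : Type*} [Field F] [Fintype F]

theorem sum_pow_finrank_hankelKer_sub {p k : ℕ} (hk : k ≤ p + 1) :
    ∑ s : Fin (2 * p + 1) → F, (Fintype.card F : ℚ) ^
        (Module.finrank F (hankelKer (coeffFunctional (2 * p + 1) s) (p + 1) (p + 1)) - k) =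
      (Fintype.card F : ℚ) ^ (2 * p + 1) +
        ((Fintype.card F : ℚ) ^ (p + 1 - k) - 1) * (Fintype.card F : ℚ) ^ (p - k) := by
  rcases hk.eq_or_lt with rfl | hlt
  · have h (s : Fin (2 * p + 1) → F) :
        Module.finrank F (hankelKer (coeffFunctional (2 * p + 1) s) (p + 1) (p + 1)) - (p + 1) = 0 :=
      Nat.sub_eq_zero_of_le (finrank_hankelKer_le _ _ _)
    simp [h]
  · simp only [← finrank_hankelKer_sub _ hk]
    have h := sum_pow_finrank_hankelKer (F := F) (N := 2 * p + 1) (a := p + 1 - k)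
      (b := p + 1 + k) (by omega) (by omega)
    rw [show 2 * p + 1 - (p + 1 + k) = p - k by omega] at h
    have h' := congrArg (Nat.cast : ℕ → ℚ) h
    rw [Nat.cast_add, Nat.cast_mul, Nat.cast_sub (Nat.one_le_pow _ _ Fintype.card_pos)] at h'
    exact_mod_cast h'

theorem sum_pow_mul_finrank_hankelKer (Q : ℚ) (p : ℕ) :
    ∑ s : Fin (2 * p + 1) → F,
        Q ^ Module.finrank F (hankelKer (coeffFunctional (2 * p + 1) s) (p + 1) (p + 1)) =
      (Fintype.card F : ℚ) ^ (2 * p + 1) + (Q ^ (p + 1) - 1) +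
        ((Fintype.card F : ℚ) ^ 2 - 1) * ∑ j ∈ Finset.range p,
          (Q ^ (j + 1) - 1) * (Fintype.card F : ℚ) ^ (2 * (p - 1 - j)) := by
  have hq : (Fintype.card F : ℚ) - 1 ≠ 0 :=
    sub_ne_zero.mpr (by exact_mod_cast Fintype.one_lt_card.ne')
  have hT := fun {k} => sum_pow_finrank_hankelKer_sub (F := F) (p := p) (k := k)
  have hcard : ((Finset.univ : Finset (Fin (2 * p + 1) → F)).card : ℚ) =
      (Fintype.card F : ℚ) ^ (2 * p + 1) := by simp
  set q : ℚ := (Fintype.card F : ℚ)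
  refine mul_left_cancel₀ hq ?_
  rw [Finset.mul_sum, Finset.sum_congr rfl fun s _ =>
    sub_one_mul_pow_eq_sum q Q (finrank_hankelKer_le (coeffFunctional (2 * p + 1) s) (p + 1) (p + 1)),
    Finset.sum_add_distrib, Finset.sum_const, nsmul_eq_mul, hcard, Finset.sum_comm]
  simp only [← Finset.mul_sum, Finset.sum_add_distrib, Finset.sum_sub_distrib]
  rw [Finset.sum_range_succ, Finset.sum_congr rfl (g := fun j => (q - 1) * (q ^ 2 - 1) *
    ((Q ^ (j + 1) - 1) * q ^ (2 * (p - 1 - j)))), ← Finset.mul_sum]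
  · have hlast (s : Fin (2 * p + 1) → F) : Module.finrank F
        (hankelKer (coeffFunctional (2 * p + 1) s) (p + 1) (p + 1)) - (p + 2) = 0 :=
      Nat.sub_eq_zero_of_le ((finrank_hankelKer_le _ _ _).trans (by omega))
    rw [hT (by omega), hT le_rfl]
    simp only [hlast, pow_zero, Finset.sum_const, nsmul_eq_mul, hcard]
    simp
    ring
  · intro j hj
    have hj := Finset.mem_range.mp hj
    rw [hT (by omega), hT (by omega), hT (by omega)]
    obtain ⟨i, rfl⟩ : ∃ i, p = j + 1 + i := ⟨p - (j + 1), by omega⟩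
    rcases i with _ | i
    · simp [show j + 1 + 1 - j = 2 by omega]
      ring
    · rw [show j + 1 + (i + 1) + 1 - j = i + 3 by omega,
        show j + 1 + (i + 1) + 1 - (j + 1) = i + 2 by omega,
        show j + 1 + (i + 1) + 1 - (j + 2) = i + 1 by omega,
        show j + 1 + (i + 1) - j = i + 2 by omega,
        show j + 1 + (i + 1) - (j + 1) = i + 1 by omega,
        show j + 1 + (i + 1) - (j + 2) = i by omega,
        show 2 * (j + 1 + (i + 1) - 1 - j) = 2 * i + 2 by omega]
      ring

end ClosedForm

/-- For `n ≥ 6` even, `q` a power of an odd prime, and `(-1)^{n/2}a₁⋯a_n` a square in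
`𝔽_q^×`, for every `P ≥ 1`:
`N(P) = (q^{n/2}-1)/(q^{n/2-1}-q)·q^{P(n-2)} - (q-1)(q^{n/2-1}+1)/(q^{n/2-1}-q)·q^{(n/2)P}`. -/
theorem count_even_square (Fq : Type) [Field Fq] [Fintype Fq] (hchar : ringChar Fq ≠ 2)
    (n : ℕ) (hn : 6 ≤ n) (hneven : Even n)
    (a : Fin n → Fq) (ha : ∀ i, a i ≠ 0)
    (hsq : IsSquare ((-1 : Fq) ^ (n / 2) * ∏ i, a i))
    (P : ℕ) (hP : 1 ≤ P) :
    (diagCount a P : ℚ) =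
      ((Fintype.card Fq : ℚ) ^ (n / 2) - 1) /
          ((Fintype.card Fq : ℚ) ^ (n / 2 - 1) - (Fintype.card Fq : ℚ)) *
          (Fintype.card Fq : ℚ) ^ (P * (n - 2)) -
        ((Fintype.card Fq : ℚ) - 1) * ((Fintype.card Fq : ℚ) ^ (n / 2 - 1) + 1) /
            ((Fintype.card Fq : ℚ) ^ (n / 2 - 1) - (Fintype.card Fq : ℚ)) *
          (Fintype.card Fq : ℚ) ^ ((n / 2) * P) := by
  obtain ⟨m, rfl⟩ := hneven
  obtain ⟨p, rfl⟩ : ∃ p, P = p + 1 := ⟨P - 1, by omega⟩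
  obtain ⟨k, rfl⟩ : ∃ k, m = k + 3 := ⟨m - 3, by omega⟩
  rw [show (k + 3 + (k + 3)) / 2 = k + 3 by omega] at hsq ⊢
  rw [diagCount_eq_card_hyperbolic hchar a ha hsq]
  have hN := congrArg (Nat.cast : ℕ → ℚ) (card_hyperbolic_mul (F := Fq) (k + 3) (p + 1))
  rw [show 2 * (p + 1) - 1 = 2 * p + 1 by omega] at hN
  push_cast at hN
  simp only [pow_right_comm _ _ (k + 3)] at hN
  rw [sum_pow_mul_finrank_hankelKer] at hN
  have hG := geometric_closed_form (Fintype.card Fq : ℚ) ((Fintype.card Fq : ℚ) ^ (k + 3)) p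
  have hq1 : (1 : ℚ) < Fintype.card Fq := by exact_mod_cast Fintype.one_lt_card
  generalize (Fintype.card Fq : ℚ) = q at *
  have hq0 : q ≠ 0 := by positivity
  have hden : q ^ (k + 1) - 1 ≠ 0 := (sub_pos.mpr (one_lt_pow₀ hq1 (by omega))).ne'
  have hden' : q ^ (k + 3 - 1) - q ≠ 0 := by
    rw [show q ^ (k + 3 - 1) - q = q * (q ^ (k + 1) - 1) by simp; ring]
    exact mul_ne_zero hq0 hden
  rw [div_mul_eq_mul_div, div_mul_eq_mul_div, ← sub_div, eq_div_iff hden']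
  refine mul_left_cancel₀ (pow_ne_zero (2 * p + 2) hq0) ?_
  rw [show (p + 1) * (k + 3 + (k + 3) - 2) = 2 * ((p + 1) * (k + 2)) by
    rw [show k + 3 + (k + 3) - 2 = 2 * (k + 2) by omega]; ring,
    show k + 3 - 1 = k + 2 by omega]
  linear_combination (q ^ (k + 3) - q ^ 2) * hN + q ^ ((k + 3) * (p + 1)) * hG
end

section
/- Let n = 4, q a power of an odd prime, f = a₁X₁²+⋯+a₄X₄² with a₁a₂a₃a₄ not a square in 𝔽_q^×. Then N(P) = q^{2P} if P is even, and N(P) = ((q²−q+1)/q)·q^{2P} if P is odd, for all P ≥ 1. -/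
open Polynomial

section HyperbolicPlusAnisotropic

variable {F : Type} [Field F]

/-- The diagonal binary form `p z² + r w²` over `F[t]`. -/
noncomputable def binaryForm (p r : F) (z w : F[X]) : F[X] := C p * z ^ 2 + C r * w ^ 2

/-- Solutions of `x y = p z² + r w²` for a fixed `x`, with `deg y < b`. -/
def HypFiber (p r : F) (x : F[X]) (b : ℕ) : Type :=
  {v : F[X] × F[X] × F[X] // v.1.degree < (b : WithBot ℕ) ∧ x * v.1 = binaryForm p r v.2.1 v.2.2}

/-- Solutions of `x y = p z² + r w²` with `deg x < a` and `deg y < b`. -/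
def HypSol (p r : F) (a b : ℕ) : Type :=
  {v : F[X] × F[X] × F[X] × F[X] // v.1.degree < (a : WithBot ℕ) ∧
    v.2.1.degree < (b : WithBot ℕ) ∧ v.1 * v.2.1 = binaryForm p r v.2.2.1 v.2.2.2}

/-- Pairs `(z, w)` of degree `< m` such that `x` divides `p z² + r w²`. -/
def DvdPairs (p r : F) (x : F[X]) (m : ℕ) : Type :=
  {v : F[X] × F[X] // (v.1.degree < (m : WithBot ℕ) ∧ v.2.degree < (m : WithBot ℕ)) ∧
    x ∣ binaryForm p r v.1 v.2}

lemma anisotropic_of_not_isSquare {p r : F} (hp : p ≠ 0) (h : ¬ IsSquare (-(p * r)))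
    {z w : F} (h0 : p * z ^ 2 + r * w ^ 2 = 0) : z = 0 ∧ w = 0 := by
  have hw : w = 0 := by
    by_contra hw
    refine h ⟨p * z / w, ?_⟩
    field_simp
    linear_combination -h0
  subst hw
  simpa [hp] using h0

lemma degree_binaryForm_lt_iff {p r : F} (hp : p ≠ 0) (h : ¬ IsSquare (-(p * r)))
    (z w : F[X]) (n : ℕ) :
    (binaryForm p r z w).degree < (n : WithBot ℕ) ↔
      z.degree < (((n + 1) / 2 : ℕ) : WithBot ℕ) ∧ w.degree < (((n + 1) / 2 : ℕ) : WithBot ℕ) := by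
  have coeff_sq (u : F[X]) (e : ℕ) (hu : u.natDegree ≤ e) :
      (u ^ 2).coeff (e + e) = u.coeff e ^ 2 := by
    rw [sq, coeff_mul_add_eq_of_natDegree_le hu hu, sq]
  by_cases h0 : z = 0 ∧ w = 0
  · obtain ⟨rfl, rfl⟩ := h0
    simp [binaryForm]
  set e := max z.natDegree w.natDegree with he
  have hz : z.natDegree ≤ e := le_max_left _ _
  have hw : w.natDegree ≤ e := le_max_right _ _
  have hc : (binaryForm p r z w).coeff (e + e) ≠ 0 := by
    rw [binaryForm, coeff_add, coeff_C_mul, coeff_C_mul, coeff_sq z e hz, coeff_sq w e hw]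
    intro hc
    obtain ⟨h1, h2⟩ := anisotropic_of_not_isSquare hp h hc
    rcases max_choice z.natDegree w.natDegree with h3 | h3
    · rw [he, h3, coeff_natDegree, leadingCoeff_eq_zero] at h1
      have hw0 : w.natDegree = 0 := by rw [h1] at h3; simpa using h3
      have : e = w.natDegree := by rw [he, h3, h1, hw0]; simp
      rw [this, coeff_natDegree, leadingCoeff_eq_zero] at h2
      exact h0 ⟨h1, h2⟩
    · rw [he, h3, coeff_natDegree, leadingCoeff_eq_zero] at h2
      have hz0 : z.natDegree = 0 := by rw [h2] at h3; simpa using h3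
      have : e = z.natDegree := by rw [he, h3, h2, hz0]; simp
      rw [this, coeff_natDegree, leadingCoeff_eq_zero] at h1
      exact h0 ⟨h1, h2⟩
  constructor
  · intro hlt
    have h2 : e + e < n := by
      by_contra hcon
      exact hc (coeff_eq_zero_of_degree_lt (hlt.trans_le (by exact_mod_cast not_lt.mp hcon)))
    have h3 : e < (n + 1) / 2 := by omega
    have h4 : ((e : ℕ) : WithBot ℕ) < (((n + 1) / 2 : ℕ) : WithBot ℕ) := by exact_mod_cast h3
    exact ⟨(degree_le_of_natDegree_le hz).trans_lt h4, (degree_le_of_natDegree_le hw).trans_lt h4⟩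
  · rintro ⟨h1, h2⟩
    have key (u : F[X]) (c : F) (hu : u.degree < (((n + 1) / 2 : ℕ) : WithBot ℕ)) :
        (C c * u ^ 2).degree < (n : WithBot ℕ) := by
      by_cases hu0 : u = 0
      · simp [hu0]
      have h5 : u.natDegree < (n + 1) / 2 := (natDegree_lt_iff_degree_lt hu0).mpr hu
      refine (degree_le_of_natDegree_le (n := u.natDegree + u.natDegree) ?_).trans_lt ?_
      · refine (natDegree_C_mul_le _ _).trans ?_
        rw [natDegree_pow]; omega
      · exact_mod_cast (by omega : u.natDegree + u.natDegree < n)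
    exact (degree_add_le _ _).trans_lt (max_lt (key z p h1) (key w r h2))

lemma binaryForm_eq_zero_iff {p r : F} (hp : p ≠ 0) (h : ¬ IsSquare (-(p * r))) (z w : F[X]) :
    binaryForm p r z w = 0 ↔ z = 0 ∧ w = 0 := by
  simpa [Nat.WithBot.lt_zero_iff] using degree_binaryForm_lt_iff hp h z w 0

lemma degree_mul_lt_natDegree_add_iff {x : F[X]} (hx : x ≠ 0) (y : F[X]) (b : ℕ) :
    (x * y).degree < ((x.natDegree + b : ℕ) : WithBot ℕ) ↔ y.degree < (b : WithBot ℕ) := by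
  by_cases hy : y = 0
  · simp [hy]
  rw [← natDegree_lt_iff_degree_lt (mul_ne_zero hx hy), ← natDegree_lt_iff_degree_lt hy,
    natDegree_mul hx hy]
  omega

lemma nonempty_hypFiber_equiv_dvdPairs {p r : F} (hp : p ≠ 0) (h : ¬ IsSquare (-(p * r)))
    {x : F[X]} (hx : x ≠ 0) (b : ℕ) :
    Nonempty (HypFiber p r x b ≃ DvdPairs p r x ((x.natDegree + b + 1) / 2)) := by
  refine ⟨Equiv.ofBijective (fun v => ⟨v.1.2, ?_, v.1.1, v.2.2.symm⟩) ⟨?_, ?_⟩⟩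
  · rw [← degree_binaryForm_lt_iff hp h, ← v.2.2]
    exact (degree_mul_lt_natDegree_add_iff hx _ _).mpr v.2.1
  · rintro ⟨⟨y, z⟩, h1, h2⟩ ⟨⟨y', z'⟩, h1', h2'⟩ heq
    obtain rfl : z = z' := congrArg Subtype.val heq
    obtain rfl : y = y' := mul_left_cancel₀ hx (h2.trans h2'.symm)
    rfl
  · rintro ⟨⟨z, w⟩, hdeg, y, hy⟩
    refine ⟨⟨(y, z, w), ?_, hy.symm⟩, rfl⟩
    rw [← degree_mul_lt_natDegree_add_iff hx, ← hy]
    exact (degree_binaryForm_lt_iff hp h _ _ _).mpr hdeg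

lemma degree_add_C_mul_lt {u z : F[X]} {m : ℕ} (hu : u.natDegree = m)
    (hz : z.degree < (m : WithBot ℕ)) (c : F) :
    (z + C c * u).degree < ((m + 1 : ℕ) : WithBot ℕ) := by
  have h1 : ((m : ℕ) : WithBot ℕ) < ((m + 1 : ℕ) : WithBot ℕ) := by exact_mod_cast m.lt_succ_self
  refine (degree_add_le _ _).trans_lt (max_lt (hz.trans h1) ?_)
  exact (degree_le_of_natDegree_le ((natDegree_C_mul_le _ _).trans hu.le)).trans_lt h1

lemma eq_of_add_C_mul_eq {u z z' : F[X]} {m : ℕ} (hu : u.natDegree = m) (hu0 : u ≠ 0)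
    (hz : z.degree < (m : WithBot ℕ)) (hz' : z'.degree < (m : WithBot ℕ)) {c c' : F}
    (heq : z + C c * u = z' + C c' * u) : z = z' ∧ c = c' := by
  have h1 := congrArg (fun f => f.coeff m) heq
  simp only [coeff_add, coeff_C_mul, coeff_eq_zero_of_degree_lt hz, coeff_eq_zero_of_degree_lt hz',
    zero_add] at h1
  have h2 : u.coeff m ≠ 0 := by rw [← hu]; simpa using hu0
  obtain rfl := mul_right_cancel₀ h2 h1
  exact ⟨add_right_cancel heq, rfl⟩

lemma exists_add_C_mul_eq {u z : F[X]} {m : ℕ} (hu : u.natDegree = m) (hu0 : u ≠ 0)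
    (hz : z.degree < ((m + 1 : ℕ) : WithBot ℕ)) :
    ∃ (z' : F[X]) (c : F), z'.degree < (m : WithBot ℕ) ∧ z' + C c * u = z := by
  have h2 : u.coeff m ≠ 0 := by rw [← hu]; simpa using hu0
  refine ⟨z - C (z.coeff m / u.coeff m) * u, z.coeff m / u.coeff m, ?_, by ring⟩
  rw [degree_lt_iff_coeff_zero] at hz ⊢
  intro k hk
  rcases hk.eq_or_lt with rfl | hk
  · simp [div_mul_cancel₀ _ h2]
  · rw [coeff_sub, coeff_C_mul, hz k hk, coeff_eq_zero_of_natDegree_lt (hu.trans_lt hk)]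
    simp

lemma dvd_binaryForm_add_mul_iff (p r : F) {x u : F[X]} (hxu : x ∣ u) (z w s t : F[X]) :
    x ∣ binaryForm p r (z + s * u) (w + t * u) ↔ x ∣ binaryForm p r z w := by
  have h1 : binaryForm p r (z + s * u) (w + t * u) = binaryForm p r z w +
      u * (C p * (2 * z * s + s ^ 2 * u) + C r * (2 * w * t + t ^ 2 * u)) := by
    simp only [binaryForm]; ring
  rw [h1, dvd_add_left (hxu.mul_right _)]

lemma nonempty_dvdPairs_succ_equiv (p r : F) {x : F[X]} (hx : x ≠ 0) {m : ℕ}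
    (hm : x.natDegree ≤ m) :
    Nonempty (DvdPairs p r x m × (F × F) ≃ DvdPairs p r x (m + 1)) := by
  set u : F[X] := x * X ^ (m - x.natDegree) with hu_def
  have hxu : x ∣ u := dvd_mul_right _ _
  have hu0 : u ≠ 0 := mul_ne_zero hx (pow_ne_zero _ X_ne_zero)
  have hu : u.natDegree = m := by
    rw [hu_def, natDegree_mul hx (pow_ne_zero _ X_ne_zero), natDegree_X_pow]; omega
  refine ⟨Equiv.ofBijective (fun v => ⟨(v.1.1.1 + C v.2.1 * u, v.1.1.2 + C v.2.2 * u),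
    ⟨degree_add_C_mul_lt hu v.1.2.1.1 _, degree_add_C_mul_lt hu v.1.2.1.2 _⟩,
    (dvd_binaryForm_add_mul_iff p r hxu _ _ _ _).mpr v.1.2.2⟩) ⟨?_, ?_⟩⟩
  · rintro ⟨⟨⟨z, w⟩, ⟨hz, hw⟩, hd⟩, c, e⟩ ⟨⟨⟨z', w'⟩, ⟨hz', hw'⟩, hd'⟩, c', e'⟩ heq
    have heq' := Prod.ext_iff.mp (congrArg Subtype.val heq)
    obtain ⟨rfl, rfl⟩ := eq_of_add_C_mul_eq hu hu0 hz hz' heq'.1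
    obtain ⟨rfl, rfl⟩ := eq_of_add_C_mul_eq hu hu0 hw hw' heq'.2
    rfl
  · rintro ⟨⟨z, w⟩, ⟨hz, hw⟩, hd⟩
    obtain ⟨z', c, hz', rfl⟩ := exists_add_C_mul_eq hu hu0 hz
    obtain ⟨w', e, hw', rfl⟩ := exists_add_C_mul_eq hu hu0 hw
    exact ⟨(⟨(z', w'), ⟨hz', hw'⟩, (dvd_binaryForm_add_mul_iff p r hxu _ _ _ _).mp hd⟩, c, e), rfl⟩

lemma nonempty_hypFiber_zero_equiv {p r : F} (hp : p ≠ 0) (h : ¬ IsSquare (-(p * r))) (b : ℕ) :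
    Nonempty (HypFiber p r 0 b ≃ (Fin b → F)) := by
  refine ⟨(Equiv.ofBijective (fun v => ⟨v.1.1, mem_degreeLT.mpr v.2.1⟩) ⟨?_, ?_⟩ :
    HypFiber p r 0 b ≃ degreeLT F b).trans (degreeLTEquiv F b).toEquiv⟩
  · rintro ⟨⟨y, z, w⟩, h1, h2⟩ ⟨⟨y', z', w'⟩, h1', h2'⟩ heq
    obtain rfl : y = y' := congrArg Subtype.val heq
    obtain ⟨rfl, rfl⟩ := (binaryForm_eq_zero_iff hp h z w).mp (by rw [← h2, zero_mul])
    obtain ⟨rfl, rfl⟩ := (binaryForm_eq_zero_iff hp h z' w').mp (by rw [← h2', zero_mul])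
    rfl
  · rintro ⟨y, hy⟩
    exact ⟨⟨(y, 0, 0), mem_degreeLT.mp hy, by simp [binaryForm]⟩, rfl⟩

lemma nonempty_hypFiber_add_two_equiv {p r : F} (hp : p ≠ 0) (h : ¬ IsSquare (-(p * r)))
    {x : F[X]} {b : ℕ} (hx : x.degree < ((b + 2 : ℕ) : WithBot ℕ)) :
    Nonempty (HypFiber p r x (b + 2) ≃ HypFiber p r x b × (F × F)) := by
  by_cases hx0 : x = 0
  · subst hx0
    obtain ⟨e⟩ := nonempty_hypFiber_zero_equiv hp h b
    obtain ⟨e'⟩ := nonempty_hypFiber_zero_equiv hp h (b + 2)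
    exact ⟨e'.trans ((Fin.appendEquiv b 2).symm.trans
      (e.symm.prodCongr (finTwoArrowEquiv F)))⟩
  · have hd : x.natDegree < b + 2 := (natDegree_lt_iff_degree_lt hx0).mpr hx
    obtain ⟨e⟩ := nonempty_hypFiber_equiv_dvdPairs hp h hx0 b
    obtain ⟨e'⟩ := nonempty_hypFiber_equiv_dvdPairs hp h hx0 (b + 2)
    obtain ⟨s⟩ := nonempty_dvdPairs_succ_equiv p r hx0
      (m := (x.natDegree + b + 1) / 2) (by omega)
    rw [show (x.natDegree + (b + 2) + 1) / 2 = (x.natDegree + b + 1) / 2 + 1 by omega] at e'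
    exact ⟨e'.trans (s.symm.trans (e.symm.prodCongr (Equiv.refl _)))⟩

/-- Solutions are fibred over the coordinate `x`. -/
def hypSolEquivSigma (p r : F) (a b : ℕ) :
    HypSol p r a b ≃ Σ x : {x : F[X] // x.degree < (a : WithBot ℕ)}, HypFiber p r x b where
  toFun v := ⟨⟨v.1.1, v.2.1⟩, ⟨v.1.2, v.2.2⟩⟩
  invFun v := ⟨(v.1.1, v.2.1), v.1.2, v.2.2⟩
  left_inv _ := rfl
  right_inv _ := rfl

/-- Exchanging the two hyperbolic coordinates. -/
def hypSolSwap (p r : F) (a b : ℕ) : HypSol p r a b ≃ HypSol p r b a where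
  toFun v := ⟨(v.1.2.1, v.1.1, v.1.2.2), v.2.2.1, v.2.1, (mul_comm _ _).trans v.2.2.2⟩
  invFun v := ⟨(v.1.2.1, v.1.1, v.1.2.2), v.2.2.1, v.2.1, (mul_comm _ _).trans v.2.2.2⟩
  left_inv _ := rfl
  right_inv _ := rfl

lemma card_hypSol_add_two {p r : F} (hp : p ≠ 0) (h : ¬ IsSquare (-(p * r))) {a b : ℕ}
    (hab : a ≤ b + 2) :
    Nat.card (HypSol p r a (b + 2)) = Nat.card F ^ 2 * Nat.card (HypSol p r a b) := by
  have key (x : {x : F[X] // x.degree < (a : WithBot ℕ)}) :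
      Nonempty (HypFiber p r x (b + 2) ≃ HypFiber p r x b × (F × F)) :=
    nonempty_hypFiber_add_two_equiv hp h (x.2.trans_le (by exact_mod_cast hab))
  rw [Nat.card_congr ((hypSolEquivSigma p r a (b + 2)).trans ((Equiv.sigmaCongrRight
    fun x => (key x).some).trans ((Equiv.sigmaProdDistrib _ _).symm.trans
      ((hypSolEquivSigma p r a b).symm.prodCongr (Equiv.refl _))))),
    Nat.card_prod, Nat.card_prod]
  ring

lemma card_hypSol_diag_add_two {p r : F} (hp : p ≠ 0) (h : ¬ IsSquare (-(p * r))) (n : ℕ) :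
    Nat.card (HypSol p r (n + 2) (n + 2)) = Nat.card F ^ 4 * Nat.card (HypSol p r n n) := by
  rw [card_hypSol_add_two hp h le_rfl, Nat.card_congr (hypSolSwap p r (n + 2) n),
    card_hypSol_add_two hp h (by omega)]
  ring

lemma card_dvdPairs_zero (p r : F) (x : F[X]) : Nat.card (DvdPairs p r x 0) = 1 := by
  rw [Nat.card_eq_one_iff_unique]
  refine ⟨⟨?_⟩, ⟨⟨(0, 0), by simp [binaryForm]⟩⟩⟩
  rintro ⟨⟨z, w⟩, ⟨hz, hw⟩, -⟩ ⟨⟨z', w'⟩, ⟨hz', hw'⟩, -⟩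
  rw [Nat.cast_zero, Nat.WithBot.lt_zero_iff, degree_eq_bot] at hz hw hz' hw'
  exact Subtype.ext (Prod.ext (hz.trans hz'.symm) (hw.trans hw'.symm))

lemma card_hypSol_zero {p r : F} (hp : p ≠ 0) (h : ¬ IsSquare (-(p * r))) :
    Nat.card (HypSol p r 0 0) = 1 := by
  rw [Nat.card_eq_one_iff_unique]
  refine ⟨⟨?_⟩, ⟨⟨(0, 0, 0, 0), by simp [binaryForm]⟩⟩⟩
  have key (v : HypSol p r 0 0) : v.1 = (0, 0, 0, 0) := by
    obtain ⟨⟨x, y, z, w⟩, hx, hy, hxy⟩ := v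
    rw [Nat.cast_zero, Nat.WithBot.lt_zero_iff, degree_eq_bot] at hx hy
    obtain rfl : x = 0 := hx
    obtain rfl : y = 0 := hy
    obtain ⟨rfl, rfl⟩ := (binaryForm_eq_zero_iff hp h z w).mp (by simpa using hxy.symm)
    rfl
  exact fun v v' => Subtype.ext ((key v).trans (key v').symm)

lemma card_hypFiber_one [Finite F] {p r : F} (hp : p ≠ 0) (h : ¬ IsSquare (-(p * r)))
    {x : F[X]} (hx : x.degree < ((1 : ℕ) : WithBot ℕ)) (hx0 : x ≠ 0) :
    Nat.card (HypFiber p r x 1) = Nat.card F ^ 2 := by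
  have hd : x.natDegree = 0 := by
    have := (natDegree_lt_iff_degree_lt hx0).mpr hx
    omega
  obtain ⟨e⟩ := nonempty_hypFiber_equiv_dvdPairs hp h hx0 1
  obtain ⟨s⟩ := nonempty_dvdPairs_succ_equiv p r hx0 hd.le
  rw [hd] at e
  rw [Nat.card_congr (e.trans s.symm), Nat.card_prod, card_dvdPairs_zero, Nat.card_prod]
  ring

lemma card_hypSol_one [Finite F] {p r : F} (hp : p ≠ 0) (h : ¬ IsSquare (-(p * r))) :
    Nat.card (HypSol p r 1 1) = Nat.card F + (Nat.card F - 1) * Nat.card F ^ 2 := by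
  classical
  have := Fintype.ofFinite F
  obtain ⟨e, he⟩ : ∃ e : F ≃ {x : F[X] // x.degree < ((1 : ℕ) : WithBot ℕ)},
      ∀ c, (e c : F[X]) = 0 ↔ c = 0 := by
    let e : {x : F[X] // x.degree < ((1 : ℕ) : WithBot ℕ)} ≃ F :=
      (Equiv.subtypeEquivRight fun _ => mem_degreeLT.symm).trans
        ((degreeLTEquiv F 1).toEquiv.trans (Equiv.funUnique (Fin 1) F))
    have h0 : e ⟨0, by simp⟩ = 0 := congrFun (map_zero (degreeLTEquiv F 1)) 0
    refine ⟨e.symm, fun c => ?_⟩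
    rw [← h0, ← Equiv.symm_apply_eq, Subtype.ext_iff]
  have hc (c : F) : Nat.card (HypFiber p r (e c) 1) =
      if c = 0 then Nat.card F else Nat.card F ^ 2 := by
    split_ifs with h0
    · obtain ⟨f⟩ := nonempty_hypFiber_zero_equiv hp h 1
      rw [(he c).mpr h0, Nat.card_congr f, Nat.card_fun]
      simp
    · exact card_hypFiber_one hp h (e c).2 (mt (he c).mp h0)
  have hfin (c : F) : Finite (HypFiber p r (e c) 1) := by
    apply Nat.finite_of_card_ne_zero
    rw [hc]
    split_ifs <;> simp
  rw [Nat.card_congr ((hypSolEquivSigma p r 1 1).trans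
    (Equiv.sigmaCongrLeft e).symm), Nat.card_sigma]
  simp only [hc]
  rw [← Finset.add_sum_erase _ _ (Finset.mem_univ (0 : F)), if_pos rfl,
    Finset.sum_congr rfl fun c hc => if_neg (Finset.ne_of_mem_erase hc)]
  simp [Nat.card_eq_fintype_card]

lemma card_hypSol_diag [Finite F] {p r : F} (hp : p ≠ 0) (h : ¬ IsSquare (-(p * r))) (n : ℕ) :
    (Nat.card (HypSol p r n n) : ℚ) =
      if Even n then (Nat.card F : ℚ) ^ (2 * n)
      else ((Nat.card F : ℚ) ^ 2 - Nat.card F + 1) / Nat.card F * (Nat.card F : ℚ) ^ (2 * n) := by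
  induction n using Nat.twoStepInduction with
  | zero => simp [card_hypSol_zero hp h]
  | one =>
    have h0 : (Nat.card F : ℚ) ≠ 0 := by exact_mod_cast Nat.card_pos.ne'
    rw [card_hypSol_one hp h, if_neg (by decide), Nat.cast_add, Nat.cast_mul,
      Nat.cast_sub Nat.card_pos]
    push_cast
    field_simp
    ring
  | more n ih _ =>
    rw [card_hypSol_diag_add_two hp h, Nat.cast_mul, ih]
    simp only [Nat.even_add, even_two, iff_true, Nat.cast_pow]
    split_ifs <;> ring

end HyperbolicPlusAnisotropic

lemma degree_C_mul_add_C_mul_lt {F : Type} [Field F] {x y : F[X]} {n : ℕ}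
    (hx : x.degree < (n : WithBot ℕ)) (hy : y.degree < (n : WithBot ℕ)) (c d : F) :
    (C c * x + C d * y).degree < (n : WithBot ℕ) := by
  rw [← mem_degreeLT] at hx hy ⊢
  rw [← smul_eq_C_mul, ← smul_eq_C_mul]
  exact add_mem (Submodule.smul_mem _ _ hx) (Submodule.smul_mem _ _ hy)

lemma exists_mul_sq_add_mul_sq_eq_neg {F : Type} [Field F] [Fintype F] (hchar : ringChar F ≠ 2)
    {a b : F} (ha : a ≠ 0) (hb : b ≠ 0) (c : F) : ∃ s t : F, a * s ^ 2 + b * t ^ 2 = -c := by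
  obtain ⟨s, t, hst⟩ := FiniteField.exists_root_sum_quadratic
    (f := C a * X ^ 2) (g := C b * X ^ 2 + C 0 * X + C c) (by simp [degree_C_mul_X_pow 2 ha])
    (degree_quadratic hb) (FiniteField.odd_card_of_char_ne_two hchar)
  refine ⟨s, t, ?_⟩
  simp only [eval_add, eval_mul, eval_C, eval_pow, eval_X, C_0, zero_mul, add_zero] at hst
  linear_combination hst

/-- A diagonal quaternary form is, up to scaling, a hyperbolic plane plus a binary form. -/
lemma diagCount_eq_card_hypSol {F : Type} [Field F] [Fintype F] (hchar : ringChar F ≠ 2)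
    (a : Fin 4 → F) (ha : ∀ i, a i ≠ 0) (hsq : ¬ IsSquare (-(-(a 0 * a 1) * (a 2 * a 3))))
    (n : ℕ) :
    diagCount a n = Nat.card (HypSol (-(a 0 * a 1)) (a 2 * a 3) n n) := by
  obtain ⟨s, t, hst⟩ := exists_mul_sq_add_mul_sq_eq_neg hchar (ha 0) (ha 1) (a 2)
  have h2 : (2 : F) ≠ 0 := Ring.two_ne_zero hchar
  have hC : C (a 0) * C s ^ 2 + C (a 1) * C t ^ 2 = -C (a 2) := by
    simp only [← C_mul, ← C_pow, ← C_add, ← C_neg, hst]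
  have hinv : C (a 2) * C (a 2)⁻¹ = 1 := by rw [← C_mul, mul_inv_cancel₀ (ha 2), C_1]
  have hhalf : C (2 : F)⁻¹ * 2 = 1 := by
    rw [show (2 : F[X]) = C 2 from rfl, ← C_mul, inv_mul_cancel₀ h2, C_1]
  let U (x : Fin 4 → F[X]) : F[X] := C (a 0 * s) * x 0 + C (a 1 * t) * x 1
  let U' (v : F[X] × F[X] × F[X] × F[X]) : F[X] := C 2⁻¹ * v.1 + C 2⁻¹ * v.2.1
  let e : (Fin 4 → F[X]) ≃ F[X] × F[X] × F[X] × F[X] :=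
    { toFun := fun x => (C 1 * U x + C (-a 2) * x 2, C 1 * U x + C (a 2) * x 2,
        C s * x 1 + C (-t) * x 0, x 3)
      invFun := fun v => ![C (-(a 2)⁻¹ * s) * U' v + C ((a 2)⁻¹ * (a 1 * t)) * v.2.2.1,
        C (-(a 2)⁻¹ * t) * U' v + C (-(a 2)⁻¹ * (a 0 * s)) * v.2.2.1,
        C (-(2⁻¹ * (a 2)⁻¹)) * v.1 + C (2⁻¹ * (a 2)⁻¹) * v.2.1, v.2.2.2]
      left_inv := fun x => by
        funext i
        fin_cases i <;>
          simp only [U, U', C_mul, C_neg, C_1, Fin.zero_eta, Fin.mk_one, Fin.reduceFinMk,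
            Matrix.cons_val]
        · linear_combination
            (-C (a 2)⁻¹ * C s * (C (a 0) * C s * x 0 + C (a 1) * C t * x 1)) * hhalf -
            C (a 2)⁻¹ * x 0 * hC + x 0 * hinv
        · linear_combination
            (-C (a 2)⁻¹ * C t * (C (a 0) * C s * x 0 + C (a 1) * C t * x 1)) * hhalf -
            C (a 2)⁻¹ * x 1 * hC + x 1 * hinv
        · linear_combination C (a 2)⁻¹ * C (a 2) * x 2 * hhalf + x 2 * hinv
      right_inv := fun v => by
        obtain ⟨x, y, z, w⟩ := v
        simp only [U, U', C_mul, C_neg, C_1, Matrix.cons_val, Prod.mk.injEq, and_true]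
        refine ⟨?_, ?_, ?_⟩
        · linear_combination
            -C (a 2)⁻¹ * (C 2⁻¹ * x + C 2⁻¹ * y) * hC +
            (C 2⁻¹ * x + C 2⁻¹ * y - C 2⁻¹ * (y - x)) * hinv + x * hhalf
        · linear_combination
            -C (a 2)⁻¹ * (C 2⁻¹ * x + C 2⁻¹ * y) * hC +
            (C 2⁻¹ * x + C 2⁻¹ * y + C 2⁻¹ * (y - x)) * hinv + y * hhalf
        · linear_combination -C (a 2)⁻¹ * z * hC + z * hinv }
  have hform (x : Fin 4 → F[X]) : (e x).1 * (e x).2.1 -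
      binaryForm (-(a 0 * a 1)) (a 2 * a 3) (e x).2.2.1 (e x).2.2.2 =
      -C (a 2) * ∑ i, C (a i) * x i ^ 2 := by
    simp only [e, U, binaryForm, Equiv.coe_fn_mk, Fin.sum_univ_four, C_mul, C_neg, C_1]
    linear_combination (C (a 0) * x 0 ^ 2 + C (a 1) * x 1 ^ 2) * hC
  have hp : -(a 0 * a 1) ≠ 0 := neg_ne_zero.mpr (mul_ne_zero (ha 0) (ha 1))
  refine Nat.card_congr (e.subtypeEquiv fun x => ?_)
  have hiff : ∑ i, C (a i) * x i ^ 2 = 0 ↔ (e x).1 * (e x).2.1 =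
      binaryForm (-(a 0 * a 1)) (a 2 * a 3) (e x).2.2.1 (e x).2.2.2 := by
    rw [← sub_eq_zero (a := (e x).1 * _), hform x, mul_eq_zero,
      or_iff_right (neg_ne_zero.mpr (C_ne_zero.mpr (ha 2)))]
  rw [hiff, ← and_assoc]
  refine and_congr_left fun heq => ⟨fun hx => ?_, fun ⟨h1, h2⟩ => ?_⟩
  · have hU : (U x).degree < (n : WithBot ℕ) := degree_C_mul_add_C_mul_lt (hx 0) (hx 1) _ _
    exact ⟨degree_C_mul_add_C_mul_lt hU (hx 2) _ _, degree_C_mul_add_C_mul_lt hU (hx 2) _ _⟩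
  · have hU : (U' (e x)).degree < (n : WithBot ℕ) := degree_C_mul_add_C_mul_lt h1 h2 _ _
    obtain ⟨h3, h4⟩ : (e x).2.2.1.degree < (n : WithBot ℕ) ∧
        (e x).2.2.2.degree < (n : WithBot ℕ) := by
      have key := degree_binaryForm_lt_iff hp hsq (e x).2.2.1 (e x).2.2.2 (n + n)
      rw [show (n + n + 1) / 2 = n by omega, ← heq] at key
      refine key.mp ?_
      by_cases hx0 : (e x).1 = 0
      · rw [hx0, zero_mul, degree_zero]; exact WithBot.bot_lt_coe _
      refine ((degree_mul_lt_natDegree_add_iff hx0 _ _).mpr h2).trans_le ?_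
      have := (natDegree_lt_iff_degree_lt hx0).mpr h1
      exact_mod_cast (by omega : (e x).1.natDegree + n ≤ n + n)
    intro i
    rw [← e.symm_apply_apply x]
    fin_cases i
    · exact degree_C_mul_add_C_mul_lt hU h3 _ _
    · exact degree_C_mul_add_C_mul_lt hU h3 _ _
    · exact degree_C_mul_add_C_mul_lt h1 h2 _ _
    · exact h4

/-- For `n = 4`, `q` a power of an odd prime, and `a₁a₂a₃a₄` not a square in `𝔽_q^×`,
for every `P ≥ 1`: `N(P) = q^{2P}` if `P` is even and `N(P) = ((q²-q+1)/q)·q^{2P}`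
if `P` is odd. -/
theorem count_four_nonsquare (Fq : Type) [Field Fq] [Fintype Fq] (hchar : ringChar Fq ≠ 2)
    (a : Fin 4 → Fq) (ha : ∀ i, a i ≠ 0) (hsq : ¬ IsSquare (∏ i, a i))
    (P : ℕ) (hP : 1 ≤ P) :
    (diagCount a P : ℚ) =
      if Even P then (Fintype.card Fq : ℚ) ^ (2 * P)
      else ((Fintype.card Fq : ℚ) ^ 2 - (Fintype.card Fq : ℚ) + 1) / (Fintype.card Fq : ℚ) *
        (Fintype.card Fq : ℚ) ^ (2 * P) := by
  have hsq' : ¬ IsSquare (-(-(a 0 * a 1) * (a 2 * a 3))) := by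
    rw [Fin.prod_univ_four] at hsq
    convert hsq using 2
    ring
  rw [diagCount_eq_card_hypSol hchar a ha hsq',
    card_hypSol_diag (neg_ne_zero.mpr (mul_ne_zero (ha 0) (ha 1))) hsq', Nat.card_eq_fintype_card]
end
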